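/- arXiv:1409.2319 — 2 statements merged into one kernel-verified Lean document; each statement's English description precedes it below -/
import Mathlib

section
/- Let (S, 𝔐) be a regular local ring of characteristic p, let 𝔄 be a proper ideal of S, set R = S/𝔄, and assume R is F-pure. Let 𝔟 be a proper ideal of R and let 𝔅 be the unique ideal of S containing 𝔄 with 𝔅/𝔄 = 𝔟. Then 𝔟 is fully Φ(E)-special if and only if (𝔄^{[p^n]} : 𝔄) ⊆ (𝔅^{[p^n]} : 𝔅) for all n ≥ 1. -/
open TensorProduct IsLocalRing DirectSum

universe u v

/-! ### Frobenius twists and base change -/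

/-- `R` viewed as an algebra over itself via the `n`-th power of the Frobenius
endomorphism; this plays the role of `R^{(n)}` (an `R`-module via `r • s = r ^ p ^ n * s`). -/
def FrobAlg (R : Type u) (p n : ℕ) [CommRing R] [Fact p.Prime] [CharP R p] : Type u := R

namespace FrobAlg

variable (R : Type u) (p n : ℕ) [CommRing R] [Fact p.Prime] [CharP R p]

instance : CommRing (FrobAlg R p n) := inferInstanceAs (CommRing R)

instance : Algebra R (FrobAlg R p n) :=
  RingHom.toAlgebra (show R →+* FrobAlg R p n from (frobenius R p) ^ n)

/-- The canonical identification of `R` with the underlying set of `R^{(n)}`. -/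
def of (r : R) : FrobAlg R p n := r

end FrobAlg

/-- The Frobenius base change `R^{(n)} ⊗_R M` of an `R`-module `M` along the `n`-th
power of the Frobenius endomorphism of `R`. -/
def FrobBC (R : Type u) (p n : ℕ) [CommRing R] [Fact p.Prime] [CharP R p]
    (M : Type v) [AddCommGroup M] [Module R M] : Type (max u v) :=
  FrobAlg R p n ⊗[R] M

namespace FrobBC

variable (R : Type u) (p n : ℕ) [CommRing R] [Fact p.Prime] [CharP R p]
  (M : Type v) [AddCommGroup M] [Module R M]

noncomputable instance : AddCommGroup (FrobBC R p n M) :=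
  inferInstanceAs (AddCommGroup (FrobAlg R p n ⊗[R] M))

/-- The `R`-module structure on `R^{(n)} ⊗_R M` given by multiplication on the first
factor. -/
noncomputable instance : Module R (FrobBC R p n M) :=
  inferInstanceAs (Module (FrobAlg R p n) (FrobAlg R p n ⊗[R] M))

variable {M}

/-- The elementary tensor `r ⊗ m` in `R^{(n)} ⊗_R M`. -/
noncomputable def tmul (r : R) (m : M) : FrobBC R p n M := FrobAlg.of R p n r ⊗ₜ[R] m

end FrobBC

/-- `R` is `F`-pure if for every `R`-module `M` the natural map
`M → R^{(1)} ⊗_R M`, `m ↦ 1 ⊗ m`, is injective. -/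
def IsFPure (R : Type u) (p : ℕ) [CommRing R] [Fact p.Prime] [CharP R p] : Prop :=
  ∀ (M : Type u) [AddCommGroup M] [Module R M],
    Function.Injective fun m : M => FrobBC.tmul R p 1 (1 : R) m

/-- An ideal `𝔞` of `R` is fully `Φ(E)`-special if for every `n ≥ 1`, every `r ∈ 𝔞` and
every `e ∈ (0 :_E 𝔞)`, the element `r ⊗ e` is zero in `R^{(n)} ⊗_R E`. -/
def IsFullyPhiSpecial (R : Type u) (p : ℕ) [CommRing R] [Fact p.Prime] [CharP R p]
    (E : Type v) [AddCommGroup E] [Module R E] (𝔞 : Ideal R) : Prop :=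
  ∀ n : ℕ, 1 ≤ n → ∀ r ∈ 𝔞, ∀ e : E, (∀ a ∈ 𝔞, a • e = 0) → FrobBC.tmul R p n r e = 0

/-! ### The module `Φ(E)` and the Frobenius shift -/

/-- The Frobenius `a ↦ a ^ p`, as an `R`-algebra map `R^{(n)} → R^{(n+1)}`. -/
def frobStepAlg (R : Type u) (p n : ℕ) [CommRing R] [Fact p.Prime] [CharP R p] :
    FrobAlg R p n →ₐ[R] FrobAlg R p (n + 1) :=
  { (show FrobAlg R p n →+* FrobAlg R p (n + 1) from frobenius R p) with
    commutes' := fun r => by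
      show frobenius R p (((frobenius R p) ^ n) r) = ((frobenius R p) ^ (n + 1)) r
      rw [pow_succ']
      rfl }

/-- The Frobenius `a ↦ a ^ p`, as an `R`-linear map `R^{(n)} → R^{(n+1)}`. -/
def frobStep (R : Type u) (p n : ℕ) [CommRing R] [Fact p.Prime] [CharP R p] :
    FrobAlg R p n →ₗ[R] FrobAlg R p (n + 1) :=
  (frobStepAlg R p n).toLinearMap

/-- The graded module `Φ(E) = ⊕_{n ≥ 0} R^{(n)} ⊗_R E`. -/
def PhiModule (R : Type u) (p : ℕ) [CommRing R] [Fact p.Prime] [CharP R p]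
    (E : Type v) [AddCommGroup E] [Module R E] : Type (max u v) :=
  ⨁ n : ℕ, FrobBC R p n E

namespace PhiModule

variable (R : Type u) (p : ℕ) [CommRing R] [Fact p.Prime] [CharP R p]
  (E : Type v) [AddCommGroup E] [Module R E]

noncomputable instance : AddCommGroup (PhiModule R p E) :=
  inferInstanceAs (AddCommGroup (⨁ n : ℕ, FrobBC R p n E))

noncomputable instance : Module R (PhiModule R p E) :=
  inferInstanceAs (Module R (⨁ n : ℕ, FrobBC R p n E))

/-- The inclusion of the `n`-th component into `Φ(E)`. -/
noncomputable def of (n : ℕ) (g : FrobBC R p n E) : PhiModule R p E :=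
  DirectSum.of (fun m : ℕ => FrobBC R p m E) n g

/-- The Frobenius-semilinear shift operator `x` on `Φ(E)`, sending an element
`r ⊗ e` of the `n`-th component to `r ^ p ⊗ e` in the `(n+1)`-th component. -/
noncomputable def shift : PhiModule R p E →+ PhiModule R p E :=
  DirectSum.toAddMonoid fun n =>
    (DirectSum.of (fun m : ℕ => FrobBC R p m E) (n + 1)).comp
      (TensorProduct.map (frobStep R p n) (LinearMap.id (R := R) (M := E))).toAddMonoidHom

end PhiModule

/-- An ideal `𝔞` of `R` is `Φ(E)`-special if it is the annihilator of an
`R[x,f]`-submodule of `Φ(E)`, i.e. of an `R`-submodule stable under the shift operator. -/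
def IsPhiSpecial (R : Type u) (p : ℕ) [CommRing R] [Fact p.Prime] [CharP R p]
    (E : Type v) [AddCommGroup E] [Module R E] (𝔞 : Ideal R) : Prop :=
  ∃ N : Submodule R (PhiModule R p E),
    (∀ g ∈ N, PhiModule.shift R p E g ∈ N) ∧ 𝔞 = N.annihilator

/-! ### Further notions -/

/-- The `q`-th bracket (Frobenius) power `I^{[q]}` of an ideal: the ideal generated by
the `q`-th powers of the elements of `I`. -/
def Ideal.bracketPow {S : Type u} [CommRing S] (I : Ideal S) (q : ℕ) : Ideal S :=
  Ideal.span ((fun x => x ^ q) '' (I : Set S))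

/-- A Noetherian local ring is regular if its maximal ideal can be generated by
`dim S` elements. -/
def IsRegularLocal (S : Type u) [CommRing S] [IsLocalRing S] : Prop :=
  ∃ s : Finset S, (s.card : WithBot (WithTop ℕ)) = ringKrullDim S ∧
    Ideal.span (s : Set S) = maximalIdeal S

/-- An ideal `𝔟` of `R` is uniformly `F`-compatible if for every `n ≥ 1` and every
`R`-linear map `φ : R^{(n)} → R` one has `φ(𝔟) ⊆ 𝔟`. -/
def UniformlyFCompatible (R : Type u) (p : ℕ) [CommRing R] [Fact p.Prime] [CharP R p]
    (𝔟 : Ideal R) : Prop :=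
  ∀ n : ℕ, 1 ≤ n → ∀ φ : FrobAlg R p n →ₗ[R] R, ∀ b ∈ 𝔟, φ (FrobAlg.of R p n b) ∈ 𝔟

/-- `R` is `F`-finite if `R^{(1)}` is a finitely generated `R`-module. -/
def IsFFinite (R : Type u) (p : ℕ) [CommRing R] [Fact p.Prime] [CharP R p] : Prop :=
  Module.Finite R (FrobAlg R p 1)

/-- A Noetherian local ring `T` of characteristic `p` is strongly `F`-regular in the
sense of Lyubeznik and Smith if the tight closure of `0` in the injective envelope of
the residue field of `T` is zero. -/
def IsStronglyFRegularLS (T : Type u) (p : ℕ) [CommRing T] [IsLocalRing T]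
    [Fact p.Prime] [CharP T p] : Prop :=
  ∀ (ET : Type u) [AddCommGroup ET] [Module T ET],
    Module.Injective T ET →
    ∀ ι : (T ⧸ maximalIdeal T) →ₗ[T] ET, Function.Injective ι →
    (∀ N : Submodule T ET, N ⊓ LinearMap.range ι = ⊥ → N = ⊥) →
    ∀ m : ET,
      (∃ c : T, (∀ P ∈ minimalPrimes T, c ∉ P) ∧
        ∃ N₀ : ℕ, ∀ n : ℕ, N₀ ≤ n → FrobBC.tmul T p n c m = 0) → m = 0

/-- `Q` is a minimal primary decomposition of the ideal `𝔄`: the `Q i` are primary,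
`𝔄` is their intersection, their radicals are pairwise distinct, and none of them
contains the intersection of the others. -/
def IsMinimalPrimaryDecomposition {S : Type u} [CommRing S] (𝔄 : Ideal S) {t : ℕ}
    (Q : Fin t → Ideal S) : Prop :=
  𝔄 = ⨅ i, Q i ∧ (∀ i, (Q i).IsPrimary) ∧
    (Function.Injective fun i => (Q i).radical) ∧
    ∀ i, ¬ (⨅ j, ⨅ (_ : j ≠ i), Q j) ≤ Q i

section RegularSequence

open RingTheory.Sequence

theorem Ideal.le_of_ringKrullDim_quotient_sup_le {R : Type u} [CommRing R] [IsLocalRing R]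
    [IsNoetherianRing R] {r : R} [IsDomain (R ⧸ Ideal.span {r})]
    (hr : r ∈ maximalIdeal R) {n : ℕ} (hdim : ringKrullDim (R ⧸ Ideal.span {r}) = n)
    (Q : Ideal R) [Q.IsPrime] (hQ : ((n + 1 : ℕ) : WithBot ℕ∞) ≤ ringKrullDim (R ⧸ Q)) :
    Q ≤ Ideal.span {r} := by
  intro q hq
  by_contra hqr
  have hlr : IsLocalRing (R ⧸ Q) :=
    IsLocalRing.of_surjective' (Ideal.Quotient.mk Q) Ideal.Quotient.mk_surjective
  have h0 : (Ideal.Quotient.mk (Ideal.span {r}) q) ∈ nonZeroDivisors (R ⧸ Ideal.span {r}) :=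
    mem_nonZeroDivisors_of_ne_zero (by rwa [Ne, Ideal.Quotient.eq_zero_iff_mem])
  have h1 := ringKrullDim_quotient_succ_le_of_nonZeroDivisor h0
  have hrm : Ideal.Quotient.mk Q r ∈ maximalIdeal (R ⧸ Q) := by
    rw [mem_maximalIdeal, mem_nonunits_iff]
    intro hu
    have := IsLocalHom.of_surjective (Ideal.Quotient.mk Q) Ideal.Quotient.mk_surjective
    exact hr (isUnit_of_map_unit (Ideal.Quotient.mk Q) r hu)
  have h2 := ringKrullDim_le_ringKrullDim_quotient_add_card
    (R := R ⧸ Q) {Ideal.Quotient.mk Q r} (by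
      simpa [IsLocalRing.ringJacobson_eq_maximalIdeal] using hrm)
  let f : R ⧸ Ideal.span {r} →+*
      (R ⧸ Q) ⧸ Ideal.span (({Ideal.Quotient.mk Q r} : Finset (R ⧸ Q)) : Set (R ⧸ Q)) :=
    Ideal.Quotient.lift _ ((Ideal.Quotient.mk _).comp (Ideal.Quotient.mk Q)) (fun a ha => by
      obtain ⟨c, rfl⟩ := Ideal.mem_span_singleton'.mp ha
      rw [RingHom.comp_apply, map_mul, map_mul]
      refine mul_eq_zero_of_right _ (Ideal.Quotient.eq_zero_iff_mem.mpr ?_)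
      exact Ideal.subset_span (by simp))
  let g : (R ⧸ Ideal.span {r}) ⧸ Ideal.span {Ideal.Quotient.mk (Ideal.span {r}) q} →+*
      (R ⧸ Q) ⧸ Ideal.span (({Ideal.Quotient.mk Q r} : Finset (R ⧸ Q)) : Set (R ⧸ Q)) :=
    Ideal.Quotient.lift _ f (fun a ha => by
      obtain ⟨c, rfl⟩ := Ideal.mem_span_singleton'.mp ha
      have : f (Ideal.Quotient.mk (Ideal.span {r}) q) = 0 := by
        simp [f, Ideal.Quotient.eq_zero_iff_mem.mpr hq]
      simp [this])
  have hg : Function.Surjective g := by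
    apply Ideal.Quotient.lift_surjective_of_surjective
    apply Ideal.Quotient.lift_surjective_of_surjective
    exact Ideal.Quotient.mk_surjective.comp Ideal.Quotient.mk_surjective
  have h3 := ringKrullDim_le_of_surjective g hg
  rw [hdim] at h1
  have h4 := (add_le_add_left h3 1).trans h1
  have h5 := hQ.trans (h2.trans (by simpa using h4))
  exact absurd (Nat.cast_le.mp h5) (by simp)

open scoped Pointwise in
/-- A regular local ring is a domain in which any minimal generating family of the maximal ideal
is a regular sequence. -/
theorem IsLocalRing.isDomain_and_isWeaklyRegular_of_ofList_eq (n : ℕ) :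
    ∀ (R : Type u) [CommRing R] [IsLocalRing R] [IsNoetherianRing R] (rs : List R),
      rs.length = n → Ideal.ofList rs = maximalIdeal R → ringKrullDim R = n →
        IsDomain R ∧ IsWeaklyRegular R rs := by
  induction n with
  | zero =>
    intro R _ _ _ rs hl hm _
    obtain rfl := List.length_eq_zero_iff.mp hl
    refine ⟨?_, IsWeaklyRegular.nil R R⟩
    rw [Ideal.ofList_nil] at hm
    exact (IsLocalRing.isField_iff_maximalIdeal_eq.mpr hm.symm).isDomain
  | succ n ih =>
    intro R _ _ _ rs hl hm hdim
    obtain ⟨r, rs, rfl⟩ := List.exists_cons_of_length_eq_add_one hl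
    have hl' : rs.length = n := by simpa using hl
    have hr : r ∈ maximalIdeal R := by
      rw [← hm]; exact Ideal.subset_span (by simp)
    have hne : Ideal.span {r} ≠ ⊤ := fun h => by
      rw [Ideal.span_singleton_eq_top] at h
      exact hr h
    have : Nontrivial (R ⧸ Ideal.span {r}) := Ideal.Quotient.nontrivial_iff.mpr hne
    have hlr : IsLocalRing (R ⧸ Ideal.span {r}) :=
      IsLocalRing.of_surjective' (Ideal.Quotient.mk _) Ideal.Quotient.mk_surjective
    have hm' : Ideal.ofList (rs.map (Ideal.Quotient.mk (Ideal.span {r}))) =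
        maximalIdeal (R ⧸ Ideal.span {r}) := by
      rw [← Ideal.map_ofList]
      have h1 : (maximalIdeal R).map (Ideal.Quotient.mk (Ideal.span {r})) =
          maximalIdeal (R ⧸ Ideal.span {r}) := by
        have hloc := IsLocalHom.of_surjective (Ideal.Quotient.mk (Ideal.span {r}))
          Ideal.Quotient.mk_surjective
        apply le_antisymm
        · exact ((IsLocalRing.local_hom_TFAE (Ideal.Quotient.mk (Ideal.span {r}))).out 0 2).mp hloc
        · intro y hy
          obtain ⟨y, rfl⟩ := Ideal.Quotient.mk_surjective y
          exact Ideal.mem_map_of_mem _ fun hu => hy (hu.map _)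
      rw [← h1, ← hm, Ideal.ofList_cons, Ideal.map_sup, Ideal.map_span]
      simp
    have hdim' : ringKrullDim (R ⧸ Ideal.span {r}) = n := by
      apply le_antisymm
      · refine (ringKrullDim_le_spanFinrank_maximalIdeal _).trans ?_
        rw [← hm']
        have := Submodule.spanFinrank_span_le_ncard_of_finite (R := R ⧸ Ideal.span {r})
          (List.finite_toSet (rs.map (Ideal.Quotient.mk (Ideal.span {r}))))
        refine Nat.cast_le.mpr (this.trans ?_)
        classical
        rw [← List.coe_toFinset, Set.ncard_coe_finset]
        exact (List.toFinset_card_le _).trans (by simp [hl'])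
      · have h2 := ringKrullDim_le_ringKrullDim_quotient_add_card (R := R) {r} (by
          simpa [IsLocalRing.ringJacobson_eq_maximalIdeal] using hr)
        rw [hdim] at h2
        rw [Finset.coe_singleton, Finset.card_singleton, Nat.cast_one] at h2
        push_cast at h2
        revert h2
        generalize ringKrullDim (R ⧸ Ideal.span {r}) = x
        intro h2
        induction x with
        | bot => simp at h2
        | coe x => 
          induction x with
          | top => exact le_top
          | coe x => 
            have : ((n + 1 : ℕ) : WithBot ℕ∞) ≤ ((x + 1 : ℕ) : WithBot ℕ∞) := by
              push_cast; exact h2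
            have := Nat.cast_le.mp this
            exact Nat.cast_le (α := WithBot ℕ∞).mpr (by omega)
    obtain ⟨hdom, hreg⟩ := ih _ _ (by simpa using hl') hm' hdim'
    obtain ⟨l, hlen⟩ := Order.le_krullDim_iff.mp (show ((n + 1 : ℕ) : WithBot ℕ∞) ≤
      Order.krullDim (PrimeSpectrum R) from hdim.ge)
    have hQp := l.head.isPrime
    have hQ : ((n + 1 : ℕ) : WithBot ℕ∞) ≤ ringKrullDim (R ⧸ l.head.asIdeal) := by
      rw [ringKrullDim_quotient]
      refine Order.le_krullDim_iff.mpr ⟨⟨l.length, fun i => ⟨l i, ?_⟩, fun i => l.step i⟩, hlen⟩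
      exact l.head_le i
    have hle := Ideal.le_of_ringKrullDim_quotient_sup_le hr hdim' l.head.asIdeal hQ
    have hrQ : r ∉ l.head.asIdeal := fun h => by
      have h1 := ringKrullDim_le_of_surjective
        (Ideal.Quotient.factor ((Ideal.span_singleton_le_iff_mem _).mpr h))
        (Ideal.Quotient.factor_surjective _)
      rw [hdim'] at h1
      exact absurd (Nat.cast_le.mp (hQ.trans h1)) (by simp)
    have hbot : l.head.asIdeal = ⊥ := by
      refine Submodule.eq_bot_of_le_smul_of_le_jacobson_bot (Ideal.span {r}) _
        (IsNoetherian.noetherian _) ?_ ?_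
      · intro y hy
        obtain ⟨z, rfl⟩ := Ideal.mem_span_singleton'.mp (hle hy)
        rw [mul_comm]
        exact Submodule.smul_mem_smul (Ideal.mem_span_singleton_self r)
          ((hQp.mem_or_mem hy).resolve_right hrQ)
      · rw [Ideal.span_singleton_le_iff_mem, IsLocalRing.jacobson_eq_maximalIdeal _ bot_ne_top]
        exact hr
    have hD : IsDomain R := by
      rw [hbot] at hQp
      exact IsDomain.of_bot_isPrime R
    refine ⟨hD, IsWeaklyRegular.cons ?_ ?_⟩
    · have hr0 : r ≠ 0 := fun h => hrQ (h ▸ zero_mem _)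
      intro a b hab
      exact mul_left_cancel₀ hr0 hab
    · have h1 : IsWeaklyRegular (R ⧸ Ideal.span {r}) rs :=
        (isWeaklyRegular_map_algebraMap_iff (R ⧸ Ideal.span {r}) (R ⧸ Ideal.span {r}) rs).mp hreg
      refine (LinearEquiv.isWeaklyRegular_congr (Submodule.quotEquivOfEq (Ideal.span {r})
        (r • ⊤ : Submodule R R) ?_) rs).mp h1
      rw [← Submodule.ideal_span_singleton_smul]; simp

end RegularSequence

section Powers

open RingTheory.Sequence

theorem RingTheory.Sequence.IsWeaklyRegular.pow_list {S : Type u} [CommRing S] [IsLocalRing S]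
    [IsNoetherianRing S] (l : List S) (a : S → ℕ) (ha : ∀ x ∈ l, 1 ≤ a x)
    (hmem : ∀ x ∈ l, x ∈ maximalIdeal S) :
    ∀ (M : Type u) [AddCommGroup M] [Module S M] [Module.Finite S M],
      IsWeaklyRegular M l → IsWeaklyRegular M (l.map fun x => x ^ a x) := by
  induction l with
  | nil => intro M _ _ _ _; exact IsWeaklyRegular.nil S M
  | cons r l ih =>
    intro M _ _ _ h
    have h1 : IsWeaklyRegular M (l ++ [r]) :=
      IsLocalRing.isWeaklyRegular_of_perm_of_subset_maximalIdeal h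
        (List.perm_append_singleton r l).symm hmem
    rw [isWeaklyRegular_append_iff, isWeaklyRegular_singleton_iff] at h1
    have h2 : IsWeaklyRegular M (l ++ [r ^ a r]) := by
      rw [isWeaklyRegular_append_iff, isWeaklyRegular_singleton_iff]
      exact ⟨h1.1, h1.2.pow _⟩
    have hr : r ^ a r ∈ maximalIdeal S :=
      Ideal.pow_mem_of_mem _ (hmem r (by simp)) _ (ha r (by simp))
    have h3 : IsWeaklyRegular M (r ^ a r :: l) := by
      refine IsLocalRing.isWeaklyRegular_of_perm_of_subset_maximalIdeal h2
        (List.perm_append_singleton _ l) ?_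
      intro x hx
      rcases List.mem_append.mp hx with hx | hx
      · exact hmem x (by simp [hx])
      · rw [List.mem_singleton.mp hx]; exact hr
    rw [isWeaklyRegular_cons_iff] at h3
    rw [List.map_cons, isWeaklyRegular_cons_iff]
    exact ⟨h3.1, ih (fun x hx => ha x (by simp [hx])) (fun x hx => hmem x (by simp [hx])) _ h3.2⟩

/-- The ideal generated by the powers `x ^ a x` of the elements of a finite set. -/
def Ideal.powSpan {S : Type u} [CommRing S] (s : Finset S) (a : S → ℕ) : Ideal S :=
  Ideal.span ((fun x => x ^ a x) '' (s : Set S))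

/-- A finite set such that each power of each of its members is a nonzerodivisor modulo any
positive powers of the others. -/
def IsPowRegular {S : Type u} [CommRing S] (s : Finset S) : Prop :=
  ∀ (t : Finset S), ∀ x ∈ s, x ∉ t → t ⊆ s → ∀ a : S → ℕ,
    ∀ z : S, x * z ∈ Ideal.powSpan t a → z ∈ Ideal.powSpan t a

theorem Ideal.powSpan_eq_top {S : Type u} [CommRing S] {s : Finset S} {a : S → ℕ} {x : S}
    (hx : x ∈ s) (ha : a x = 0) : Ideal.powSpan s a = ⊤ :=
  (Ideal.eq_top_iff_one _).mpr (Ideal.subset_span ⟨x, hx, by simp [ha]⟩)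

theorem IsRegularLocal.exists_isPowRegular {S : Type u} [CommRing S] [IsNoetherianRing S]
    [IsLocalRing S] (h : IsRegularLocal S) :
    ∃ s : Finset S, Ideal.span (s : Set S) = maximalIdeal S ∧ IsPowRegular s := by
  classical
  obtain ⟨s, hcard, hspan⟩ := h
  refine ⟨s, hspan, ?_⟩
  have hlist : Ideal.ofList s.toList = maximalIdeal S := by
    rw [← hspan, Ideal.ofList]; simp
  have hreg := (IsLocalRing.isDomain_and_isWeaklyRegular_of_ofList_eq s.card S s.toList
    (by simp) hlist hcard.symm).2
  have hmem : ∀ x ∈ s, x ∈ maximalIdeal S := fun x hx => hspan ▸ Ideal.subset_span hx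
  intro t x hxs hxt hts a z hz
  by_cases ha : ∃ y ∈ t, a y = 0
  · obtain ⟨y, hy, h0⟩ := ha
    rw [Ideal.powSpan_eq_top hy h0]; trivial
  push Not at ha
  have hperm : s.toList.Perm (t.toList ++ (x :: ((s \ t).erase x).toList)) := by
    refine (List.perm_ext_iff_of_nodup s.nodup_toList ?_).mpr ?_
    · rw [List.nodup_append]
      refine ⟨t.nodup_toList, by simp [Finset.nodup_toList], ?_⟩
      intro y hy w hw
      rintro rfl
      simp at hy hw
      rcases hw with rfl | hw
      · exact hxt hy
      · exact hw.2.2 hy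
    · intro y
      simp only [Finset.mem_toList, List.mem_append, List.mem_cons, Finset.mem_erase,
        Finset.mem_sdiff]
      constructor
      · intro hy; tauto
      · rintro (hy | rfl | hy)
        · exact hts hy
        · exact hxs
        · exact hy.2.1
  have h1 := IsLocalRing.isWeaklyRegular_of_perm_of_subset_maximalIdeal hreg hperm
    (fun r hr => hmem r (by simpa using hr))
  let b : S → ℕ := fun y => if y ∈ t then a y else 1
  have h2 := RingTheory.Sequence.IsWeaklyRegular.pow_list _ b
    (fun y _ => by
      by_cases hy : y ∈ t
      · simpa [b, hy] using Nat.one_le_iff_ne_zero.mpr (ha y hy)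
      · simp [b, hy])
    (fun y hy => hmem y (by simpa using hperm.mem_iff.mpr hy)) S h1
  rw [List.map_append, List.map_cons, isWeaklyRegular_append_iff, isWeaklyRegular_cons_iff] at h2
  have h3 := h2.2.1
  have hI : (Ideal.ofList (t.toList.map fun y => y ^ b y) • ⊤ : Submodule S S) =
      Ideal.powSpan t a := by
    rw [smul_eq_mul, Ideal.mul_top, Ideal.ofList, Ideal.powSpan]
    congr 1
    ext w
    simp only [List.mem_map, Finset.mem_toList, Set.mem_ofPred_eq, Set.mem_image, Finset.mem_coe]
    constructor <;> rintro ⟨y, hy, rfl⟩ <;> exact ⟨y, hy, by simp [b, hy]⟩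
  rw [hI] at h3
  have hbx : b x = 1 := by simp [b, hxt]
  rw [hbx, pow_one] at h3
  rw [← Submodule.Quotient.mk_eq_zero]
  apply h3
  change x • Submodule.Quotient.mk z = x • 0
  rw [← Submodule.Quotient.mk_smul, smul_zero, Submodule.Quotient.mk_eq_zero]
  exact hz

end Powers

section PowSpan

variable {S : Type u} [CommRing S] {s : Finset S}

theorem Ideal.powSpan_mono {a b : S → ℕ} (h : ∀ x ∈ s, a x ≤ b x) :
    Ideal.powSpan s b ≤ Ideal.powSpan s a := by
  refine Ideal.span_le.mpr ?_
  rintro _ ⟨x, hx, rfl⟩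
  exact Ideal.mem_of_dvd _ (pow_dvd_pow x (h x hx)) (Ideal.subset_span ⟨x, hx, rfl⟩)

theorem Ideal.powSpan_congr {a b : S → ℕ} (h : ∀ x ∈ s, a x = b x) :
    Ideal.powSpan s a = Ideal.powSpan s b :=
  le_antisymm (Ideal.powSpan_mono fun x hx => (h x hx).ge)
    (Ideal.powSpan_mono fun x hx => (h x hx).le)

theorem Ideal.powSpan_eq_sup [DecidableEq S] (a : S → ℕ) {x : S} (hx : x ∈ s) :
    Ideal.powSpan s a = Ideal.span {x ^ a x} ⊔ Ideal.powSpan (s.erase x) a := by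
  rw [Ideal.powSpan, Ideal.powSpan, ← Ideal.span_union]
  congr 1
  conv_lhs => rw [← Finset.insert_erase hx]
  rw [Finset.coe_insert, Set.image_insert_eq, Set.singleton_union]

theorem Ideal.mem_powSpan_iff [DecidableEq S] {a : S → ℕ} {x : S} (hx : x ∈ s) {z : S} :
    z ∈ Ideal.powSpan s a ↔ ∃ c, z - c * x ^ a x ∈ Ideal.powSpan (s.erase x) a := by
  rw [Ideal.powSpan_eq_sup a hx, Ideal.mem_span_singleton_sup]
  constructor
  · rintro ⟨c, w, hw, rfl⟩
    exact ⟨c, by simpa using hw⟩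
  · rintro ⟨c, hc⟩
    exact ⟨c, _, hc, by ring⟩

theorem IsPowRegular.mem_of_mul_mem [DecidableEq S] (h : IsPowRegular s) {a b : S → ℕ} {x : S}
    (hx : x ∈ s) (hbx : b x = a x + 1) (hb : ∀ y ∈ s, y ≠ x → b y = a y) {z : S}
    (hz : x * z ∈ Ideal.powSpan s b) : z ∈ Ideal.powSpan s a := by
  obtain ⟨c, hc⟩ := (Ideal.mem_powSpan_iff hx).mp hz
  refine (Ideal.mem_powSpan_iff hx).mpr ⟨c, h _ x hx (Finset.notMem_erase x s)
    (Finset.erase_subset x s) a _ ?_⟩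
  rw [Ideal.powSpan_congr (b := b) fun y hy =>
    (hb y (Finset.mem_of_mem_erase hy) (Finset.ne_of_mem_erase hy)).symm]
  convert hc using 1
  rw [hbx]; ring

theorem IsPowRegular.mem_of_pow_mul_mem [DecidableEq S] (h : IsPowRegular s) {x : S}
    (hx : x ∈ s) {a : S → ℕ} (n : ℕ) : ∀ {b : S → ℕ}, b x = a x + n →
    (∀ y ∈ s, y ≠ x → b y = a y) → ∀ {z : S},
    x ^ n * z ∈ Ideal.powSpan s b → z ∈ Ideal.powSpan s a := by
  induction n with
  | zero =>
    intro b hbx hb z hz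
    rw [Ideal.powSpan_congr (b := b)]
    · simpa using hz
    · intro y hy
      by_cases hyx : y = x
      · rw [hyx, hbx, add_zero]
      · exact (hb y hy hyx).symm
  | succ n ih =>
    intro b hbx hb z hz
    refine ih (b := Function.update b x (a x + n)) (by simp)
      (fun y hy hyx => by rw [Function.update_of_ne hyx, hb y hy hyx]) ?_
    refine h.mem_of_mul_mem hx (b := b) (by rw [hbx]; simp; ring)
      (fun y _ hyx => by rw [Function.update_of_ne hyx]) ?_
    rwa [← mul_assoc, ← pow_succ']

theorem IsPowRegular.mem_of_prod_mul_mem (h : IsPowRegular s) (a e : S → ℕ) {z : S}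
    (hz : (∏ x ∈ s, x ^ e x) * z ∈ Ideal.powSpan s (fun x => a x + e x)) :
    z ∈ Ideal.powSpan s a := by
  classical
  have key : ∀ T ⊆ s, ∀ z, (∏ x ∈ T, x ^ e x) * z ∈
      Ideal.powSpan s (fun x => a x + if x ∈ T then e x else 0) → z ∈ Ideal.powSpan s a := by
    intro T
    induction T using Finset.induction_on with
    | empty => intro _ z hz; simpa using hz
    | insert y T hy ih =>
      intro hT z hz
      rw [Finset.insert_subset_iff] at hT
      refine ih hT.2 z (h.mem_of_pow_mul_mem hT.1 (e y) (b := fun x => a x +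
        if x ∈ insert y T then e x else 0) (by simp [hy]) ?_ ?_)
      · intro w _ hw
        simp [hw]
      · rwa [Finset.prod_insert hy, mul_assoc] at hz
  refine key s subset_rfl z ?_
  rwa [Ideal.powSpan_congr (b := fun x => a x + e x)]
  intro x hx; simp [hx]

theorem Ideal.prod_mul_mem_powSpan (a e : S → ℕ) {z : S} (hz : z ∈ Ideal.powSpan s a) :
    (∏ x ∈ s, x ^ e x) * z ∈ Ideal.powSpan s (fun x => a x + e x) := by
  induction hz using Submodule.span_induction with
  | mem z hz =>
    obtain ⟨x, hx, rfl⟩ := hz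
    refine Ideal.mem_of_dvd _ ?_ (Ideal.subset_span ⟨x, hx, rfl⟩)
    dsimp only
    rw [pow_add, mul_comm]
    exact mul_dvd_mul (Finset.dvd_prod_of_mem _ hx) dvd_rfl
  | zero => simp
  | add x y _ _ hx hy => rw [mul_add]; exact add_mem hx hy
  | smul c x _ hx =>
    rw [smul_eq_mul, mul_left_comm]; exact Ideal.mul_mem_left _ _ hx

theorem IsPowRegular.exists_sub_prod_mul_mem (h : IsPowRegular s) (t : ℕ) {z : S}
    (hz : ∀ x ∈ s, x * z ∈ Ideal.powSpan s fun _ => t + 1) :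
    ∃ c, z - (∏ x ∈ s, x) ^ t * c ∈ Ideal.powSpan s fun _ => t + 1 := by
  classical
  have key : ∀ T ⊆ s, ∃ c, z - (∏ x ∈ s, x ^ (if x ∈ T then t else 0)) * c ∈
      Ideal.powSpan s fun _ => t + 1 := by
    intro T
    induction T using Finset.induction_on with
    | empty => intro _; exact ⟨z, by simp⟩
    | insert y T hy ih =>
      intro hT
      rw [Finset.insert_subset_iff] at hT
      obtain ⟨c, hc⟩ := ih hT.2
      let b : S → ℕ := fun x => if x ∈ T then 1 else t + 1
      let e : S → ℕ := fun x => if x ∈ T then t else 0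
      have hbe : ∀ x, b x + e x = t + 1 := fun x => by
        by_cases hx : x ∈ T <;> simp [b, e, hx, add_comm]
      have hP : (Ideal.powSpan s fun x => b x + e x) = Ideal.powSpan s fun _ => t + 1 :=
        Ideal.powSpan_congr fun x _ => hbe x
      have h1 : y * c ∈ Ideal.powSpan s b := by
        refine h.mem_of_prod_mul_mem b e ?_
        rw [hP]
        have := sub_mem (hz y hT.1) (Ideal.mul_mem_left _ y hc)
        convert this using 1
        simp only [e]
        ring
      have h2 : c ∈ Ideal.powSpan s (Function.update b y t) :=
        h.mem_of_mul_mem hT.1 (b := b) (by simp [b, hy])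
          (fun w _ hw => by simp [hw]) h1
      obtain ⟨d, hd⟩ := (Ideal.mem_powSpan_iff hT.1).mp h2
      rw [Function.update_self] at hd
      have h3 : c - d * y ^ t ∈ Ideal.powSpan s b := by
        rw [Ideal.powSpan_eq_sup b hT.1]
        refine Ideal.mem_sup_right ?_
        rwa [Ideal.powSpan_congr (b := Function.update b y t)]
        intro w hw
        rw [Function.update_of_ne (Finset.ne_of_mem_erase hw)]
      refine ⟨d, ?_⟩
      have h4 := Ideal.prod_mul_mem_powSpan b e h3
      rw [hP] at h4
      convert add_mem hc h4 using 1
      have h5 : (∏ x ∈ s, x ^ (if x ∈ insert y T then t else 0)) =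
          (∏ x ∈ s, x ^ e x) * y ^ t := by
        rw [← Finset.mul_prod_erase s _ hT.1, ← Finset.mul_prod_erase s (fun x => x ^ e x) hT.1]
        have : ∏ x ∈ s.erase y, x ^ (if x ∈ insert y T then t else 0) =
            ∏ x ∈ s.erase y, x ^ e x := Finset.prod_congr rfl fun x hx => by
          simp [e, Finset.ne_of_mem_erase hx]
        rw [this]
        simp [e, hy, mul_comm]
      rw [h5]
      simp only [e]
      ring
  obtain ⟨c, hc⟩ := key s subset_rfl
  refine ⟨c, ?_⟩
  rw [← Finset.prod_pow]
  convert hc using 4 with x hx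
  simp [hx]

theorem IsPowRegular.length_quotient_update [DecidableEq S] (h : IsPowRegular s) (a : S → ℕ)
    {x : S} (hx : x ∈ s) (n : ℕ) :
    Module.length S (S ⧸ Ideal.powSpan s (Function.update a x n)) =
      n * Module.length S (S ⧸ Ideal.powSpan s (Function.update a x 1)) := by
  induction n with
  | zero =>
    have : Subsingleton (S ⧸ Ideal.powSpan s (Function.update a x 0)) := by
      rw [Ideal.Quotient.subsingleton_iff]
      exact Ideal.powSpan_eq_top hx (by simp)
    simp
  | succ n ih =>
    set I := Ideal.powSpan s (Function.update a x n) with hI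
    set J := Ideal.powSpan s (Function.update a x (n + 1)) with hJ
    set K := Ideal.powSpan s (Function.update a x 1) with hK
    have herase : ∀ m k, Ideal.powSpan (s.erase x) (Function.update a x m) =
        Ideal.powSpan (s.erase x) (Function.update a x k) := fun m k =>
      Ideal.powSpan_congr fun y hy => by
        rw [Function.update_of_ne (Finset.ne_of_mem_erase hy),
          Function.update_of_ne (Finset.ne_of_mem_erase hy)]
    have hmul : I ≤ Submodule.comap (LinearMap.mulLeft S x) J := by
      intro z hz
      obtain ⟨c, hc⟩ := (Ideal.mem_powSpan_iff hx).mp hz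
      refine (Ideal.mem_powSpan_iff hx).mpr ⟨c, ?_⟩
      rw [herase (n + 1) n]
      convert Ideal.mul_mem_left _ x hc using 1
      simp
      ring
    have hJK : J ≤ K := Ideal.powSpan_mono fun y _ => by
      by_cases hy : y = x
      · subst hy; simp
      · simp [hy]
    have hex := Module.length_eq_add_of_exact (R := S)
      (Submodule.mapQ I J (LinearMap.mulLeft S x) hmul) (Submodule.factor hJK) ?_
      (Submodule.factor_surjective hJK) ?_
    · rw [hex, ih]
      push_cast
      ring
    · rw [← LinearMap.ker_eq_bot, LinearMap.ker_eq_bot']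
      intro z hz
      obtain ⟨z, rfl⟩ := Submodule.Quotient.mk_surjective _ z
      rw [Submodule.mapQ_apply, Submodule.Quotient.mk_eq_zero] at hz
      rw [Submodule.Quotient.mk_eq_zero]
      exact h.mem_of_mul_mem hx (b := Function.update a x (n + 1)) (by simp)
        (fun y _ hy => by simp [hy]) hz
    · intro z
      obtain ⟨z, rfl⟩ := Submodule.Quotient.mk_surjective _ z
      constructor
      · intro hz
        rw [← Submodule.mkQ_apply, Submodule.factor_mk, Submodule.mkQ_apply,
          Submodule.Quotient.mk_eq_zero] at hz
        obtain ⟨c, hc⟩ := (Ideal.mem_powSpan_iff hx).mp hz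
        refine ⟨Submodule.Quotient.mk c, ?_⟩
        rw [Submodule.mapQ_apply, eq_comm, Submodule.Quotient.eq]
        refine (Ideal.mem_powSpan_iff hx).mpr ⟨0, ?_⟩
        rw [herase (n + 1) 1]
        convert hc using 1
        simp
        ring
      · rintro ⟨c, hc⟩
        obtain ⟨c, rfl⟩ := Submodule.Quotient.mk_surjective _ c
        rw [← hc, Submodule.mapQ_apply, ← Submodule.mkQ_apply, Submodule.factor_mk,
          Submodule.mkQ_apply, Submodule.Quotient.mk_eq_zero]
        refine Ideal.mul_mem_right _ _ (Ideal.subset_span ⟨x, hx, by simp⟩)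

theorem IsPowRegular.length_quotient_powSpan [IsLocalRing S] (h : IsPowRegular s)
    (hs : Ideal.span (s : Set S) = maximalIdeal S) (a : S → ℕ) :
    Module.length S (S ⧸ Ideal.powSpan s a) = ((∏ x ∈ s, a x : ℕ) : ℕ∞) := by
  classical
  have key : ∀ T ⊆ s, Module.length S (S ⧸ Ideal.powSpan s a) = ((∏ x ∈ T, a x : ℕ) : ℕ∞) *
      Module.length S (S ⧸ Ideal.powSpan s fun x => if x ∈ T then 1 else a x) := by
    intro T
    induction T using Finset.induction_on with
    | empty => intro _; simp; rfl
    | insert y T hy ih =>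
      intro hT
      rw [Finset.insert_subset_iff] at hT
      have h1 := h.length_quotient_update (fun x => if x ∈ T then 1 else a x) hT.1 (a y)
      have h2 : Function.update (fun x => if x ∈ T then 1 else a x) y (a y) =
          fun x => if x ∈ T then 1 else a x := by
        ext x
        by_cases hx : x = y
        · subst hx; simp [hy]
        · simp [hx]
      have h3 : Function.update (fun x => if x ∈ T then 1 else a x) y 1 =
          fun x => if x ∈ insert y T then 1 else a x := by
        ext x
        by_cases hx : x = y
        · subst hx; simp
        · simp [hx]
      rw [h2, h3] at h1
      rw [ih hT.2, h1, Finset.prod_insert hy]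
      push_cast
      ring
  have h1 : (Ideal.powSpan s fun x => if x ∈ s then 1 else a x) = maximalIdeal S := by
    rw [Ideal.powSpan_congr (b := fun _ => 1) (fun x hx => by simp [hx]), ← hs, Ideal.powSpan]
    simp
  have h2 := key s subset_rfl
  rw [h1] at h2
  have : IsSimpleModule S (S ⧸ maximalIdeal S) := by
    rw [isSimpleModule_iff_isCoatom]
    exact Ideal.isMaximal_def.mp inferInstance
  rw [h2, Module.length_eq_one, mul_one]

end PowSpan

section Length

variable {S : Type*} [CommRing S]

theorem Module.length_eq_ker_add_range {M N : Type*} [AddCommGroup M] [Module S M] [AddCommGroup N]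
    [Module S N] (f : M →ₗ[S] N) :
    Module.length S M = Module.length S (LinearMap.ker f) + Module.length S (LinearMap.range f) :=
  Module.length_eq_add_of_exact (LinearMap.ker f).subtype f.rangeRestrict
    (LinearMap.ker f).injective_subtype f.surjective_rangeRestrict (by
      intro x
      simp [Subtype.ext_iff])

theorem Module.length_le_add_of_exact {X Y Z : Type*} [AddCommGroup X] [Module S X]
    [AddCommGroup Y] [Module S Y] [AddCommGroup Z] [Module S Z] (f : X →ₗ[S] Y) (g : Y →ₗ[S] Z)
    (hfg : LinearMap.ker g ≤ LinearMap.range f) :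
    Module.length S Y ≤ Module.length S X + Module.length S Z := by
  rw [Module.length_eq_ker_add_range g]
  exact add_le_add ((Module.length_le_of_injective _ (Submodule.inclusion_injective hfg)).trans
    (Module.length_le_of_surjective _ f.surjective_rangeRestrict))
    (Module.length_le_of_injective _ (Submodule.injective_subtype _))

theorem IsSimpleModule.smul_eq_zero_of_mem_maximalIdeal [IsLocalRing S] {X : Type*}
    [AddCommGroup X] [Module S X] [IsSimpleModule S X] {m : S} (hm : m ∈ maximalIdeal S) (x : X) :
    m • x = 0 := by
  have h := IsSimpleModule.annihilator_isMaximal (R := S) (M := X)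
  rw [← IsLocalRing.eq_maximalIdeal h] at hm
  exact Module.mem_annihilator.mp hm x

/-- Semilinear maps out of a module of finite length have length at most the length of the source
times the length of the part of the target killed by the image of the maximal ideal. -/
theorem IsFiniteLength.length_semilinearMap_le [IsLocalRing S] (σ : S →+* S) {D : Type*}
    [AddCommGroup D] [Module S D] {l : ℕ∞}
    (hD : Module.length S (Submodule.torsionBySet S D (σ '' (maximalIdeal S : Set S))) ≤ l)
    {N : Type*} [AddCommGroup N] [Module S N] (hN : IsFiniteLength S N) :
    Module.length S (N →ₛₗ[σ] D) ≤ l * Module.length S N := by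
  induction hN with
  | of_subsingleton => simp
  | @of_simple_quotient M _ _ N _ _ ih =>
    let r : (M →ₛₗ[σ] D) →ₗ[S] (N →ₛₗ[σ] D) :=
      { toFun := fun f => f.comp N.subtype
        map_add' := fun _ _ => rfl
        map_smul' := fun _ _ => rfl }
    have hr : ∀ f, r f = 0 ↔ ∀ x ∈ N, f x = 0 := fun f => by
      simp [r, LinearMap.ext_iff]
    obtain ⟨g, hg⟩ : ∃ g, g ∉ N := by
      by_contra! hall
      have : Subsingleton (M ⧸ N) :=
        Submodule.Quotient.subsingleton_iff.mpr (by ext; simp [hall])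
      exact not_nontrivial _ (IsSimpleModule.nontrivial S (M ⧸ N))
    have hco : IsCoatom N := isSimpleModule_iff_isCoatom.mp inferInstance
    have htop : N ⊔ S ∙ g = ⊤ := hco.2 _ (by
      refine lt_of_le_of_ne le_sup_left fun h => hg ?_
      rw [h]
      exact Submodule.mem_sup_right (Submodule.mem_span_singleton_self g))
    let ev : LinearMap.ker r →ₗ[S] Submodule.torsionBySet S D (σ '' (maximalIdeal S : Set S)) :=
      LinearMap.codRestrict _
        { toFun := fun f => f.1 g
          map_add' := fun _ _ => rfl
          map_smul' := fun _ _ => rfl }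
        (by
          intro f
          rw [Submodule.mem_torsionBySet_iff]
          rintro ⟨_, m, hm, rfl⟩
          show σ m • f.1 g = 0
          rw [← map_smulₛₗ]
          refine (hr _).mp f.2 _ ?_
          rw [← Submodule.Quotient.mk_eq_zero, Submodule.Quotient.mk_smul]
          exact IsSimpleModule.smul_eq_zero_of_mem_maximalIdeal hm _)
    have hev : Function.Injective ev := by
      rw [← LinearMap.ker_eq_bot, LinearMap.ker_eq_bot']
      intro f hf
      have hfg : f.1 g = 0 := congrArg Subtype.val hf
      ext x
      have hx : x ∈ N ⊔ S ∙ g := htop ▸ Submodule.mem_top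
      obtain ⟨y, hy, z, hz, rfl⟩ := Submodule.mem_sup.mp hx
      obtain ⟨c, rfl⟩ := Submodule.mem_span_singleton.mp hz
      simp [map_smulₛₗ, hfg, (hr _).mp f.2 y hy]
    rw [Module.length_eq_ker_add_range r, Module.length_eq_add_of_exact N.subtype N.mkQ
      N.injective_subtype N.mkQ_surjective (LinearMap.exact_subtype_mkQ N),
      Module.length_eq_one S (M ⧸ N), mul_add, mul_one, add_comm]
    exact add_le_add ((Module.length_le_of_injective _ (Submodule.injective_subtype _)).trans ih)
      ((Module.length_le_of_injective ev hev).trans hD)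

end Length

section ConstPowSpan

variable {S : Type u} [CommRing S] {s : Finset S}

/-- The ideal generated by the `t`-th powers of the elements of a finite set. -/
abbrev Ideal.constPowSpan (s : Finset S) (t : ℕ) : Ideal S :=
  Ideal.powSpan s fun _ => t

theorem Ideal.constPowSpan_one : Ideal.constPowSpan s 1 = Ideal.span (s : Set S) := by
  simp [Ideal.constPowSpan, Ideal.powSpan]

theorem Ideal.constPowSpan_le_pow (t : ℕ) :
    Ideal.constPowSpan s t ≤ Ideal.span (s : Set S) ^ t := by
  refine Ideal.span_le.mpr ?_
  rintro _ ⟨x, hx, rfl⟩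
  exact Ideal.pow_mem_pow (Ideal.subset_span hx) t

theorem Ideal.exists_pow_le_constPowSpan (t : ℕ) :
    ∃ N, Ideal.span (s : Set S) ^ N ≤ Ideal.constPowSpan s t :=
  Ideal.exists_pow_le_of_le_radical_of_fg
    (Ideal.span_le.mpr fun x hx => ⟨t, Ideal.subset_span ⟨x, hx, rfl⟩⟩) ⟨s, rfl⟩

theorem Ideal.bracketPow_eq_map (p n : ℕ) [Fact p.Prime] [CharP S p] (I : Ideal S) :
    I.bracketPow (p ^ n) = I.map (iterateFrobenius S p n) := by
  rw [Ideal.bracketPow, Ideal.map]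
  congr 1

theorem Ideal.bracketPow_constPowSpan (p n : ℕ) [Fact p.Prime] [CharP S p] (t : ℕ) :
    (Ideal.constPowSpan s t).bracketPow (p ^ n) = Ideal.constPowSpan s (t * p ^ n) := by
  rw [Ideal.bracketPow_eq_map, Ideal.constPowSpan, Ideal.powSpan, Ideal.map_span, Set.image_image]
  congr 1
  ext
  simp [iterateFrobenius_def, pow_mul]

theorem IsPowRegular.prod_pow_mul_mem_iff (h : IsPowRegular s) (t k : ℕ) {z : S} :
    (∏ x ∈ s, x) ^ k * z ∈ Ideal.constPowSpan s (t + k) ↔ z ∈ Ideal.constPowSpan s t := by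
  rw [← Finset.prod_pow]
  exact ⟨h.mem_of_prod_mul_mem (fun _ => t) fun _ => k,
    Ideal.prod_mul_mem_powSpan (fun _ => t) fun _ => k⟩

variable [IsLocalRing S]

theorem IsPowRegular.prod_pow_notMem (h : IsPowRegular s)
    (hs : Ideal.span (s : Set S) = maximalIdeal S) (t : ℕ) :
    (∏ x ∈ s, x) ^ t ∉ Ideal.constPowSpan s (t + 1) := by
  intro hmem
  rw [← mul_one (_ ^ t), add_comm, h.prod_pow_mul_mem_iff, Ideal.constPowSpan_one, hs] at hmem
  exact (Ideal.ne_top_iff_one _).mp (Ideal.IsMaximal.ne_top inferInstance) hmem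

theorem IsPowRegular.prod_pow_mul_mem_of_mem (h : IsPowRegular s)
    (hs : Ideal.span (s : Set S) = maximalIdeal S) (t : ℕ) {c : S} (hc : c ∈ maximalIdeal S) :
    (∏ x ∈ s, x) ^ t * c ∈ Ideal.constPowSpan s (t + 1) := by
  rwa [add_comm, h.prod_pow_mul_mem_iff, Ideal.constPowSpan_one, hs]

theorem IsPowRegular.exists_mul_sub_prod_pow_mem (h : IsPowRegular s)
    (hs : Ideal.span (s : Set S) = maximalIdeal S) (t : ℕ) {z : S}
    (hz : z ∉ Ideal.constPowSpan s (t + 1)) :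
    ∃ c, c * z - (∏ x ∈ s, x) ^ t ∈ Ideal.constPowSpan s (t + 1) := by
  have hex : ∃ N, ∀ m ∈ maximalIdeal S ^ N, m * z ∈ Ideal.constPowSpan s (t + 1) := by
    obtain ⟨N, hN⟩ := Ideal.exists_pow_le_constPowSpan (s := s) (t + 1)
    rw [hs] at hN
    exact ⟨N, fun m hm => Ideal.mul_mem_right _ _ (hN hm)⟩
  classical
  obtain ⟨k, hk⟩ : ∃ k, Nat.find hex = k + 1 := by
    refine Nat.exists_eq_succ_of_ne_zero fun h0 => hz ?_
    have := Nat.find_spec hex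
    rw [h0] at this
    simpa using this 1 (by simp)
  have hmin := Nat.find_min hex (m := k) (by omega)
  push Not at hmin
  obtain ⟨m, hm, hmz⟩ := hmin
  have hsoc : ∀ x ∈ s, x * (m * z) ∈ Ideal.powSpan s fun _ => t + 1 := by
    intro x hx
    rw [← mul_assoc]
    refine Nat.find_spec hex _ ?_
    rw [hk, pow_succ']
    exact Ideal.mul_mem_mul (hs ▸ Ideal.subset_span hx) hm
  obtain ⟨c, hc⟩ := h.exists_sub_prod_mul_mem t hsoc
  have hcu : IsUnit c := by
    by_contra hcu
    refine hmz ?_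
    have := Ideal.add_mem _ hc (h.prod_pow_mul_mem_of_mem hs t ((mem_maximalIdeal c).mpr hcu))
    simpa using this
  obtain ⟨d, hd⟩ := hcu.exists_left_inv
  refine ⟨d * m, ?_⟩
  convert Ideal.mul_mem_left _ d hc using 1
  linear_combination (∏ x ∈ s, x) ^ t * hd

theorem IsPowRegular.length_torsionBySet_quotient_le (h : IsPowRegular s)
    (hs : Ideal.span (s : Set S) = maximalIdeal S) (t : ℕ) :
    Module.length S (Submodule.torsionBySet S (S ⧸ Ideal.constPowSpan s t)
      (RingHom.id S '' (maximalIdeal S : Set S))) ≤ 1 := by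
  cases t with
  | zero =>
    rcases s.eq_empty_or_nonempty with rfl | ⟨x, hx⟩
    · have hM : Ideal.constPowSpan (∅ : Finset S) 0 = maximalIdeal S := by
        rw [← hs]; simp [Ideal.constPowSpan, Ideal.powSpan]
      have : IsSimpleModule S (S ⧸ Ideal.constPowSpan (∅ : Finset S) 0) := by
        rw [hM, isSimpleModule_iff_isCoatom]
        exact Ideal.isMaximal_def.mp inferInstance
      rw [← Module.length_eq_one S (S ⧸ Ideal.constPowSpan (∅ : Finset S) 0)]
      exact Module.length_le_of_injective _ (Submodule.injective_subtype _)
    · have : Subsingleton (S ⧸ Ideal.constPowSpan s 0) :=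
        Ideal.Quotient.subsingleton_iff.mpr (Ideal.powSpan_eq_top hx rfl)
      simp
  | succ t =>
    let f : (S ⧸ maximalIdeal S) →ₗ[S] S ⧸ Ideal.constPowSpan s (t + 1) :=
      Submodule.mapQ _ _ (LinearMap.mulLeft S ((∏ x ∈ s, x) ^ t))
        fun c hc => h.prod_pow_mul_mem_of_mem hs t hc
    have hsimple : IsSimpleModule S (S ⧸ maximalIdeal S) := by
      rw [isSimpleModule_iff_isCoatom]
      exact Ideal.isMaximal_def.mp inferInstance
    have hle : Submodule.torsionBySet S (S ⧸ Ideal.constPowSpan s (t + 1))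
        (RingHom.id S '' (maximalIdeal S : Set S)) ≤ LinearMap.range f := by
      intro z hz
      obtain ⟨z, rfl⟩ := Submodule.Quotient.mk_surjective _ z
      rw [Submodule.mem_torsionBySet_iff] at hz
      obtain ⟨c, hc⟩ := h.exists_sub_prod_mul_mem t (z := z) fun x hx => by
        rw [← smul_eq_mul, ← Submodule.Quotient.mk_eq_zero, Submodule.Quotient.mk_smul]
        exact hz ⟨x, x, hs ▸ Ideal.subset_span hx, rfl⟩
      refine ⟨Submodule.Quotient.mk c, ?_⟩
      rw [eq_comm]
      exact (Submodule.Quotient.eq _).mpr hc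
    calc _ ≤ Module.length S (LinearMap.range f) :=
          Module.length_le_of_injective _ (Submodule.inclusion_injective hle)
      _ ≤ Module.length S (S ⧸ maximalIdeal S) :=
          Module.length_le_of_surjective _ f.surjective_rangeRestrict
      _ = 1 := Module.length_eq_one S _

theorem IsPowRegular.isFiniteLength_quotient (h : IsPowRegular s)
    (hs : Ideal.span (s : Set S) = maximalIdeal S) (t : ℕ) :
    IsFiniteLength S (S ⧸ Ideal.constPowSpan s t) := by
  rw [← Module.length_ne_top_iff, h.length_quotient_powSpan hs]
  exact ENat.natCast_ne_top _

theorem IsPowRegular.length_torsionBySet_iterateFrobenius_le (p n : ℕ) [Fact p.Prime] [CharP S p]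
    (h : IsPowRegular s) (hs : Ideal.span (s : Set S) = maximalIdeal S) (t : ℕ) :
    Module.length S (Submodule.torsionBySet S (S ⧸ Ideal.constPowSpan s t)
      (iterateFrobenius S p n '' (maximalIdeal S : Set S))) ≤
      Module.length S (S ⧸ Ideal.constPowSpan s (p ^ n)) := by
  set D := S ⧸ Ideal.constPowSpan s t
  have hP : Ideal.constPowSpan s (p ^ n) =
      Ideal.span (iterateFrobenius S p n '' (maximalIdeal S : Set S)) := by
    rw [← one_mul (p ^ n), ← Ideal.bracketPow_constPowSpan, Ideal.bracketPow_eq_map,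
      Ideal.constPowSpan_one, hs, Ideal.map]
  let f : Submodule.torsionBySet S D (iterateFrobenius S p n '' (maximalIdeal S : Set S)) →ₗ[S]
      ((S ⧸ Ideal.constPowSpan s (p ^ n)) →ₗ[S] D) :=
    { toFun := fun d => Submodule.liftQ _ (LinearMap.toSpanSingleton S D d.1) (by
        rw [hP, Ideal.span_le]
        intro a ha
        exact (Submodule.mem_torsionBySet_iff _ _).mp d.2 ⟨a, ha⟩)
      map_add' := fun d d' => by
        refine Submodule.linearMap_qext _ (LinearMap.ext_ring ?_)
        show (1 : S) • (d + d').1 = (1 : S) • d.1 + (1 : S) • d'.1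
        simp
      map_smul' := fun c d => by
        refine Submodule.linearMap_qext _ (LinearMap.ext_ring ?_)
        show (1 : S) • (c • d).1 = c • (1 : S) • d.1
        simp }
  have hf : Function.Injective f := by
    intro d d' hd
    have h1 : (1 : S) • d.1 = (1 : S) • d'.1 :=
      LinearMap.congr_fun hd (Submodule.Quotient.mk 1)
    rwa [one_smul, one_smul, ← Subtype.ext_iff] at h1
  refine (Module.length_le_of_injective f hf).trans ?_
  have := (h.isFiniteLength_quotient hs (p ^ n)).length_semilinearMap_le (RingHom.id S)
    (h.length_torsionBySet_quotient_le hs t)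
  rwa [one_mul] at this

end ConstPowSpan

section Duality

variable {S : Type u} [CommRing S] {s : Finset S}

/-- The Frobenius power map from `S ⧸ (x ^ t : x ∈ s)` to `S ⧸ (x ^ (t q) : x ∈ s)`. -/
noncomputable def frobQuotient (p n : ℕ) [Fact p.Prime] [CharP S p] (s : Finset S) (t : ℕ) :
    (S ⧸ Ideal.constPowSpan s t) →ₛₗ[iterateFrobenius S p n]
      (S ⧸ Ideal.constPowSpan s (t * p ^ n)) :=
  Submodule.liftQ _
    { toFun := fun v => Submodule.Quotient.mk (iterateFrobenius S p n v)
      map_add' := fun v w => by rw [map_add]; rfl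
      map_smul' := fun c v => by rw [smul_eq_mul, map_mul]; rfl } (by
    intro v hv
    refine (Submodule.Quotient.mk_eq_zero _).mpr ?_
    rw [← Ideal.bracketPow_constPowSpan, Ideal.bracketPow_eq_map]
    exact Ideal.mem_map_of_mem _ hv)

theorem frobQuotient_mk (p n : ℕ) [Fact p.Prime] [CharP S p] (s : Finset S) (t : ℕ) (v : S) :
    frobQuotient p n s t (Submodule.Quotient.mk v) = Submodule.Quotient.mk (v ^ p ^ n) :=
  rfl

/-- Multiples of the Frobenius power map, restricted to a submodule. -/
noncomputable def frobQuotientMul (p n : ℕ) [Fact p.Prime] [CharP S p] (s : Finset S) (t : ℕ)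
    (J : Submodule S (S ⧸ Ideal.constPowSpan s t)) :
    (S ⧸ Ideal.constPowSpan s (t * p ^ n)) →ₗ[S]
      (J →ₛₗ[iterateFrobenius S p n] S ⧸ Ideal.constPowSpan s (t * p ^ n)) where
  toFun d := ((LinearMap.mulLeft S d).comp (frobQuotient p n s t)).comp J.subtype
  map_add' _ _ := LinearMap.ext fun _ => add_mul _ _ _
  map_smul' _ _ := LinearMap.ext fun _ => smul_mul_assoc _ _ _

theorem frobQuotientMul_mk (p n : ℕ) [Fact p.Prime] [CharP S p] (s : Finset S) (t : ℕ)
    (J : Submodule S (S ⧸ Ideal.constPowSpan s t)) (u v : S) (hv : Submodule.Quotient.mk v ∈ J) :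
    frobQuotientMul p n s t J (Submodule.Quotient.mk u) ⟨Submodule.Quotient.mk v, hv⟩ =
      Submodule.Quotient.mk (u * v ^ p ^ n) :=
  rfl

variable [IsLocalRing S]

theorem IsPowRegular.length_quotient_mul_pow (p n : ℕ) (h : IsPowRegular s)
    (hs : Ideal.span (s : Set S) = maximalIdeal S) (t : ℕ) :
    Module.length S (S ⧸ Ideal.constPowSpan s (t * p ^ n)) =
      Module.length S (S ⧸ Ideal.constPowSpan s (p ^ n)) *
        Module.length S (S ⧸ Ideal.constPowSpan s t) := by
  rw [h.length_quotient_powSpan hs, h.length_quotient_powSpan hs, h.length_quotient_powSpan hs,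
    Finset.prod_mul_distrib, mul_comm]
  push_cast
  rfl

theorem IsPowRegular.range_frobQuotientMul (p n : ℕ) [Fact p.Prime] [CharP S p]
    (h : IsPowRegular s) (hs : Ideal.span (s : Set S) = maximalIdeal S) (t : ℕ)
    (J : Submodule S (S ⧸ Ideal.constPowSpan s t)) :
    LinearMap.range (frobQuotientMul p n s t J) = ⊤ ∧
      Module.length S (LinearMap.range (frobQuotientMul p n s t J)) =
        Module.length S (S ⧸ Ideal.constPowSpan s (p ^ n)) * Module.length S J := by
  set Q := S ⧸ Ideal.constPowSpan s t
  set D := S ⧸ Ideal.constPowSpan s (t * p ^ n)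
  set l := Module.length S (S ⧸ Ideal.constPowSpan s (p ^ n)) with hl
  set β := frobQuotientMul p n s t J
  have hD := h.length_torsionBySet_iterateFrobenius_le p n hs (t * p ^ n)
  have hQ := h.isFiniteLength_quotient hs t
  have hQlen := Module.length_eq_add_of_exact J.subtype J.mkQ
    J.injective_subtype J.mkQ_surjective (LinearMap.exact_subtype_mkQ J)
  have hQtop := Module.length_ne_top_iff.mpr hQ
  have hltop : l ≠ ⊤ := Module.length_ne_top_iff.mpr (h.isFiniteLength_quotient hs (p ^ n))
  have hJtop : Module.length S J ≠ ⊤ := fun h0 => hQtop (by rw [hQlen, h0, top_add])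
  have hQJtop : Module.length S (Q ⧸ J) ≠ ⊤ := fun h0 => hQtop (by rw [hQlen, h0, add_top])
  have hJ : Module.length S (J →ₛₗ[iterateFrobenius S p n] D) ≤ l * Module.length S J :=
    (Module.length_ne_top_iff.mp hJtop).length_semilinearMap_le _ hD
  have hQJ : Module.length S ((Q ⧸ J) →ₛₗ[iterateFrobenius S p n] D) ≤
      l * Module.length S (Q ⧸ J) :=
    (Module.length_ne_top_iff.mp hQJtop).length_semilinearMap_le _ hD
  let γ : LinearMap.ker β →ₗ[S] ((Q ⧸ J) →ₛₗ[iterateFrobenius S p n] D) :=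
    { toFun := fun d => J.liftQ ((LinearMap.mulLeft S d.1).comp (frobQuotient p n s t))
        fun x hx => LinearMap.congr_fun (LinearMap.mem_ker.mp d.2) ⟨x, hx⟩
      map_add' := fun d d' => Submodule.linearMap_qext _ (LinearMap.ext fun _ => add_mul _ _ _)
      map_smul' := fun c d =>
        Submodule.linearMap_qext _ (LinearMap.ext fun _ => smul_mul_assoc _ _ _) }
  have hγ : Function.Injective γ := by
    intro d d' hd
    have h1 : d.1 * frobQuotient p n s t (Submodule.Quotient.mk 1) =
        d'.1 * frobQuotient p n s t (Submodule.Quotient.mk 1) :=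
      LinearMap.congr_fun hd (Submodule.Quotient.mk (Submodule.Quotient.mk 1))
    have h2 : frobQuotient p n s t (Submodule.Quotient.mk 1) = 1 := by
      rw [frobQuotient_mk, one_pow]; rfl
    rwa [h2, mul_one, mul_one, ← Subtype.ext_iff] at h1
  have hker := (Module.length_le_of_injective γ hγ).trans hQJ
  have hsum := Module.length_eq_ker_add_range β
  rw [h.length_quotient_mul_pow p n hs t, ← hl, hQlen, mul_add, add_comm] at hsum
  have htop1 : l * Module.length S (Q ⧸ J) ≠ ⊤ := WithTop.mul_ne_top hltop hQJtop
  have htop2 : l * Module.length S J ≠ ⊤ := WithTop.mul_ne_top hltop hJtop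
  have hrange : Module.length S (LinearMap.range β) ≤
      Module.length S (J →ₛₗ[iterateFrobenius S p n] D) :=
    Module.length_le_of_injective _ (Submodule.injective_subtype _)
  have hge : l * Module.length S J ≤ Module.length S (LinearMap.range β) := by
    refine (ENat.add_le_add_iff_left htop1).mp ?_
    rw [hsum]
    exact add_le_add hker le_rfl
  refine ⟨?_, le_antisymm (hrange.trans hJ) hge⟩
  by_contra hne
  have hfin := Module.length_ne_top_iff.mp (ne_top_of_le_ne_top htop2 hJ)
  obtain ⟨_, _⟩ := isFiniteLength_iff_isNoetherian_isArtinian.mp hfin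
  exact ((Submodule.length_lt hne).trans_le (hJ.trans hge)).false

/-- Every Frobenius-semilinear map from a submodule of `S ⧸ (x ^ t : x ∈ s)` is a multiple of the
Frobenius power map. -/
theorem IsPowRegular.exists_semilinearMap_eq (p n : ℕ) [Fact p.Prime] [CharP S p]
    (h : IsPowRegular s) (hs : Ideal.span (s : Set S) = maximalIdeal S) (t : ℕ)
    (J : Submodule S (S ⧸ Ideal.constPowSpan s t))
    (f : J →ₛₗ[iterateFrobenius S p n] S ⧸ Ideal.constPowSpan s (t * p ^ n)) :
    ∃ u : S, ∀ (v : S) (hv : Submodule.Quotient.mk v ∈ J),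
      f ⟨Submodule.Quotient.mk v, hv⟩ = Submodule.Quotient.mk (u * v ^ p ^ n) := by
  obtain ⟨d, rfl⟩ : f ∈ LinearMap.range (frobQuotientMul p n s t J) := by
    rw [(h.range_frobQuotientMul p n hs t J).1]
    trivial
  obtain ⟨u, rfl⟩ := Submodule.Quotient.mk_surjective _ d
  exact ⟨u, fun v hv => frobQuotientMul_mk p n s t J u v hv⟩

theorem IsPowRegular.length_quotient_eq (p n : ℕ) [Fact p.Prime] [CharP S p]
    (h : IsPowRegular s) (hs : Ideal.span (s : Set S) = maximalIdeal S) (t : ℕ)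
    (J : Submodule S (S ⧸ Ideal.constPowSpan s t)) (C : Ideal S)
    (hC : ∀ u, u ∈ C ↔ ∀ v : S, Submodule.Quotient.mk v ∈ J →
      u * v ^ p ^ n ∈ Ideal.constPowSpan s (t * p ^ n)) :
    Module.length S (S ⧸ C) =
      Module.length S (S ⧸ Ideal.constPowSpan s (p ^ n)) * Module.length S J := by
  let α := (frobQuotientMul p n s t J).comp (Submodule.mkQ _)
  have hker : LinearMap.ker α = C := by
    ext u
    rw [LinearMap.mem_ker, hC]
    constructor
    · intro hu v hv
      rw [← Submodule.Quotient.mk_eq_zero, ← frobQuotientMul_mk p n s t J u v hv]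
      exact LinearMap.congr_fun hu _
    · intro hu
      ext ⟨v, hv⟩
      obtain ⟨v, rfl⟩ := Submodule.Quotient.mk_surjective _ v
      exact (frobQuotientMul_mk p n s t J u v hv).trans
        ((Submodule.Quotient.mk_eq_zero _).mpr (hu v hv))
  have hrange : LinearMap.range α = LinearMap.range (frobQuotientMul p n s t J) := by
    rw [LinearMap.range_comp, Submodule.range_mkQ, Submodule.map_top]
  rw [← (h.range_frobQuotientMul p n hs t J).2, ← hrange, ← hker]
  exact α.quotKerEquivRange.length_eq

end Duality

section FrobeniusDuality

variable {S : Type u} [CommRing S] {s : Finset S} [IsLocalRing S]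

theorem IsLocalRing.length_quotient_maximalIdeal :
    Module.length S (S ⧸ maximalIdeal S) = 1 := by
  have : IsSimpleModule S (S ⧸ maximalIdeal S) := by
    rw [isSimpleModule_iff_isCoatom]
    exact Ideal.isMaximal_def.mp inferInstance
  exact Module.length_eq_one S _

theorem IsPowRegular.length_torsionBySet_quotient_eq (h : IsPowRegular s)
    (hs : Ideal.span (s : Set S) = maximalIdeal S) (p : ℕ) [Fact p.Prime] [CharP S p]
    (t : ℕ) (B : Ideal S) :
    Module.length S (Submodule.torsionBySet S (S ⧸ Ideal.constPowSpan s t) (B : Set S)) =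
      Module.length S (S ⧸ B ⊔ Ideal.constPowSpan s t) := by
  set P := Ideal.constPowSpan s t with hP
  set K := Submodule.torsionBySet S (S ⧸ P) (B : Set S)
  set J := Submodule.map P.mkQ (B ⊔ P)
  set C : Ideal S := Submodule.comap P.mkQ K
  have hC : ∀ u, u ∈ C ↔ ∀ b ∈ B, b * u ∈ P := fun u => by
    simp only [C, K, Submodule.mem_comap, Submodule.mem_torsionBySet_iff, Subtype.forall,
      SetLike.mem_coe, Submodule.mkQ_apply]
    exact forall₂_congr fun b _ => Submodule.Quotient.mk_eq_zero P
  have hPC : P ≤ C := fun u hu => (hC u).mpr fun b _ => Ideal.mul_mem_left _ _ hu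
  have hKC : Submodule.map P.mkQ C = K :=
    Submodule.map_comap_eq_of_surjective P.mkQ_surjective K
  have hlen := h.length_quotient_eq p 0 hs t J C fun u => by
    simp only [pow_zero, pow_one, mul_one, hC, ← hP]
    constructor
    · intro hu v hv
      obtain ⟨w, hw, hwv⟩ := hv
      obtain ⟨b, hb, c, hc, rfl⟩ := Submodule.mem_sup.mp hw
      have hsub := (Submodule.Quotient.eq _).mp hwv
      have h1 : u * v = b * u + c * u - u * (b + c - v) := by ring
      rw [h1]
      exact Ideal.sub_mem _ (Ideal.add_mem _ (hu b hb) (Ideal.mul_mem_right _ _ hc))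
        (Ideal.mul_mem_left _ _ hsub)
    · intro hu b hb
      rw [mul_comm]
      exact hu b ⟨b, Ideal.mem_sup_left hb, rfl⟩
  rw [pow_zero, Ideal.constPowSpan_one, hs, IsLocalRing.length_quotient_maximalIdeal,
    one_mul] at hlen
  have hK := Module.length_eq_add_of_exact K.subtype K.mkQ
    K.injective_subtype K.mkQ_surjective (LinearMap.exact_subtype_mkQ K)
  have hJ := Module.length_eq_add_of_exact J.subtype J.mkQ
    J.injective_subtype J.mkQ_surjective (LinearMap.exact_subtype_mkQ J)
  have eK : Module.length S ((S ⧸ P) ⧸ K) = Module.length S (S ⧸ C) := by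
    rw [← hKC]
    exact (Submodule.quotientQuotientEquivQuotient P C hPC).length_eq
  have eJ : Module.length S ((S ⧸ P) ⧸ J) = Module.length S (S ⧸ B ⊔ P) :=
    (Submodule.quotientQuotientEquivQuotient P (B ⊔ P) le_sup_right).length_eq
  have htop := Module.length_ne_top_iff.mpr (h.isFiniteLength_quotient hs t)
  rw [← hP] at htop
  have hJtop : Module.length S J ≠ ⊤ := fun h0 => htop (by rw [hJ, h0, top_add])
  rw [eK, hlen, hJ, eJ, add_comm] at hK
  exact ((ENat.addLECancellable_of_ne_top hJtop).inj.mp (by rw [add_comm, hK, add_comm])).symm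

theorem Ideal.length_quotient_map_le [IsNoetherianRing S] (σ : S →+* S) (N : ℕ) (I : Ideal S)
    (hI : maximalIdeal S ^ N ≤ I) :
    Module.length S (S ⧸ I.map σ) ≤
      Module.length S (S ⧸ (maximalIdeal S).map σ) * Module.length S (S ⧸ I) := by
  induction I using IsNoetherian.induction with
  | hgt I ih =>
  by_cases htop : I = ⊤
  · subst htop
    have : Subsingleton (S ⧸ (⊤ : Ideal S).map σ) :=
      Ideal.Quotient.subsingleton_iff.mpr (Ideal.map_top σ)
    simp
  obtain ⟨y, hyI, hy⟩ : ∃ y, y ∉ I ∧ ∀ m ∈ maximalIdeal S, m * y ∈ I := by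
    have hex : ∃ N, maximalIdeal S ^ N ≤ I := ⟨N, hI⟩
    classical
    obtain ⟨k, hk⟩ : ∃ k, Nat.find hex = k + 1 := by
      refine Nat.exists_eq_succ_of_ne_zero fun h0 => htop ?_
      have := Nat.find_spec hex
      rw [h0] at this
      simpa using this
    have hmin := Nat.find_min hex (m := k) (by omega)
    obtain ⟨y, hy, hyI⟩ := SetLike.not_le_iff_exists.mp hmin
    refine ⟨y, hyI, fun m hm => Nat.find_spec hex ?_⟩
    rw [hk, pow_succ']
    exact Ideal.mul_mem_mul hm hy
  set J : Ideal S := I ⊔ Ideal.span {y} with hJ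
  have hIJ : I ≤ J := le_sup_left
  have hlt : I < J := lt_of_le_of_ne hIJ fun h0 =>
    hyI (h0 ▸ Ideal.mem_sup_right (Ideal.mem_span_singleton_self y))
  have h1 : 1 + Module.length S (S ⧸ J) ≤ Module.length S (S ⧸ I) := by
    have hker := Module.length_eq_ker_add_range (Submodule.factor hIJ)
    rw [LinearMap.range_eq_top.mpr (Submodule.factor_surjective hIJ), Module.length_top] at hker
    rw [hker]
    refine add_le_add (Order.one_le_iff_pos.mpr ?_) le_rfl
    rw [Module.length_pos_iff, Submodule.nontrivial_iff_ne_bot, Submodule.ne_bot_iff]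
    refine ⟨Submodule.Quotient.mk y, ?_, fun h0 => hyI ((Submodule.Quotient.mk_eq_zero _).mp h0)⟩
    exact (Submodule.Quotient.mk_eq_zero _).mpr
      (Ideal.mem_sup_right (Ideal.mem_span_singleton_self y))
  have h2 : Module.length S (S ⧸ Ideal.map σ I) ≤
      Module.length S (S ⧸ (maximalIdeal S).map σ) + Module.length S (S ⧸ J.map σ) := by
    have hmul : (maximalIdeal S).map σ ≤
        Submodule.comap (LinearMap.mulLeft S (σ y)) (Ideal.map σ I) := by
      refine Ideal.map_le_iff_le_comap.mpr fun m hm => ?_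
      show σ y * σ m ∈ Ideal.map σ I
      rw [← map_mul, mul_comm]
      exact Ideal.mem_map_of_mem σ (hy m hm)
    refine Module.length_le_add_of_exact
      (Submodule.mapQ _ _ (LinearMap.mulLeft S (σ y)) hmul)
      (Submodule.factor (Ideal.map_mono hIJ)) fun z hz => ?_
    obtain ⟨z, rfl⟩ := Submodule.Quotient.mk_surjective _ z
    have hz' : z ∈ J.map σ := (Submodule.Quotient.mk_eq_zero _).mp hz
    rw [hJ, Ideal.map_sup, Ideal.map_span, Set.image_singleton] at hz'
    obtain ⟨a, ha, b, hb, rfl⟩ := Submodule.mem_sup.mp hz'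
    obtain ⟨c, rfl⟩ := Ideal.mem_span_singleton.mp hb
    refine ⟨Submodule.Quotient.mk c, ?_⟩
    rw [Submodule.mapQ_apply, eq_comm, Submodule.Quotient.eq]
    simpa using ha
  calc _ ≤ _ := h2
    _ ≤ Module.length S (S ⧸ (maximalIdeal S).map σ) +
        Module.length S (S ⧸ (maximalIdeal S).map σ) * Module.length S (S ⧸ J) :=
      add_le_add le_rfl (ih J hlt (hI.trans hIJ))
    _ = Module.length S (S ⧸ (maximalIdeal S).map σ) * (1 + Module.length S (S ⧸ J)) := by ring
    _ ≤ _ := mul_le_mul_right h1 _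

/-- Elements carrying `q`-th powers from `(x ^ t : x ∈ s) : B` into `(x ^ (t q) : x ∈ s)` lie in
`B^[q] + (x ^ (t q) : x ∈ s)`. -/
theorem IsPowRegular.mem_bracketPow_sup [IsNoetherianRing S] (p n : ℕ) [Fact p.Prime] [CharP S p]
    (h : IsPowRegular s) (hs : Ideal.span (s : Set S) = maximalIdeal S) (t : ℕ) (B : Ideal S)
    {u : S} (hu : ∀ v : S, (∀ b ∈ B, b * v ∈ Ideal.constPowSpan s t) →
      u * v ^ p ^ n ∈ Ideal.constPowSpan s (t * p ^ n)) :
    u ∈ B.bracketPow (p ^ n) ⊔ Ideal.constPowSpan s (t * p ^ n) := by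
  set P := Ideal.constPowSpan s t with hP
  set σ := iterateFrobenius S p n with hσ
  let C : Ideal S :=
    { carrier := {u | ∀ v : S, (∀ b ∈ B, b * v ∈ P) →
        u * v ^ p ^ n ∈ Ideal.constPowSpan s (t * p ^ n)}
      zero_mem' := fun v _ => by simp
      add_mem' := fun ha hb v hv => by
        rw [add_mul]
        exact Ideal.add_mem _ (ha v hv) (hb v hv)
      smul_mem' := fun c a ha v hv => by
        rw [smul_eq_mul, mul_assoc]
        exact Ideal.mul_mem_left _ _ (ha v hv) }
  have hmap : (B ⊔ P).map σ = B.bracketPow (p ^ n) ⊔ Ideal.constPowSpan s (t * p ^ n) := by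
    rw [Ideal.map_sup, ← Ideal.bracketPow_eq_map, ← Ideal.bracketPow_eq_map,
      Ideal.bracketPow_constPowSpan]
  have hle : (B ⊔ P).map σ ≤ C := by
    rw [hmap]
    refine sup_le ?_ fun a ha v _ => Ideal.mul_mem_right _ _ ha
    refine Ideal.span_le.mpr ?_
    rintro _ ⟨b, hb, rfl⟩ v hv
    rw [← mul_pow, ← Ideal.bracketPow_constPowSpan]
    exact Ideal.subset_span ⟨_, hv b hb, rfl⟩
  have hC := h.length_quotient_eq p n hs t (Submodule.torsionBySet S _ (B : Set S)) C fun u => by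
    refine forall_congr' fun v => ?_
    simp only [Submodule.mem_torsionBySet_iff, Subtype.forall, SetLike.mem_coe,
      ← Submodule.Quotient.mk_smul, Submodule.Quotient.mk_eq_zero, smul_eq_mul, hP]
  rw [h.length_torsionBySet_quotient_eq hs p t B] at hC
  obtain ⟨N, hN⟩ := Ideal.exists_pow_le_constPowSpan (s := s) t
  have hbound := Ideal.length_quotient_map_le σ N (B ⊔ P) (by
    rw [← hs]
    exact hN.trans le_sup_right)
  have hM : (maximalIdeal S).map σ = Ideal.constPowSpan s (p ^ n) := by
    rw [← hs, ← Ideal.bracketPow_eq_map, ← Ideal.constPowSpan_one,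
      Ideal.bracketPow_constPowSpan, one_mul]
  rw [hM, ← hC] at hbound
  have hker := Module.length_eq_ker_add_range (Submodule.factor hle)
  rw [LinearMap.range_eq_top.mpr (Submodule.factor_surjective hle), Module.length_top] at hker
  have hCtop : Module.length S (S ⧸ C) ≠ ⊤ := by
    refine ne_top_of_le_ne_top
      (Module.length_ne_top_iff.mpr (h.isFiniteLength_quotient hs (t * p ^ n))) ?_
    have hPC : Ideal.constPowSpan s (t * p ^ n) ≤ C :=
      le_trans (hmap ▸ le_sup_right) hle
    exact Module.length_le_of_surjective _ (Submodule.factor_surjective hPC)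
  have hzero : Module.length S (LinearMap.ker (Submodule.factor hle)) = 0 := by
    rw [hker] at hbound
    refine le_antisymm ((ENat.add_le_add_iff_right hCtop).mp ?_) bot_le
    rwa [zero_add]
  rw [Module.length_eq_zero_iff, Submodule.subsingleton_iff_eq_bot,
    LinearMap.ker_eq_bot'] at hzero
  rw [← hmap, ← Submodule.Quotient.mk_eq_zero]
  exact hzero _ ((Submodule.Quotient.mk_eq_zero _).mpr hu)

end FrobeniusDuality

section ResidueHull

variable {S : Type u} [CommRing S] [IsLocalRing S]

/-- The properties of an injective hull of the residue field of `S ⧸ 𝔄` that can be expressed in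
terms of its structure of `S`-module. -/
structure Ideal.IsResidueHull (𝔄 : Ideal S) (E : Type u) [AddCommGroup E] [Module S E] : Prop where
  smul_eq_zero : ∀ a ∈ 𝔄, ∀ e : E, a • e = 0
  exists_extension : ∀ (X Y : Type u) [AddCommGroup X] [Module S X] [AddCommGroup Y] [Module S Y]
    (f : X →ₗ[S] Y), Function.Injective f → (∀ a ∈ 𝔄, ∀ y : Y, a • y = 0) →
    ∀ g : X →ₗ[S] E, ∃ g' : Y →ₗ[S] E, ∀ x, g' (f x) = g x
  exists_pow_smul_eq_zero : ∀ e : E, ∃ N, ∀ m ∈ maximalIdeal S ^ N, m • e = 0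
  exists_socle : ∃ ε : E, ε ≠ 0 ∧ (∀ m ∈ maximalIdeal S, m • ε = 0) ∧
    ∀ e : E, (∀ m ∈ maximalIdeal S, m • e = 0) → ∃ c : S, e = c • ε

theorem Ideal.isResidueHull [IsNoetherianRing S] (𝔄 : Ideal S) [IsLocalRing (S ⧸ 𝔄)]
    (E : Type u) [AddCommGroup E] [Module (S ⧸ 𝔄) E] [Module S E] [IsScalarTower S (S ⧸ 𝔄) E]
    (hE : Module.Injective (S ⧸ 𝔄) E)
    (ι : ((S ⧸ 𝔄) ⧸ maximalIdeal (S ⧸ 𝔄)) →ₗ[S ⧸ 𝔄] E) (hι : Function.Injective ι)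
    (hess : ∀ N : Submodule (S ⧸ 𝔄) E, N ⊓ LinearMap.range ι = ⊥ → N = ⊥) :
    𝔄.IsResidueHull E := by
  have hmk : ∀ (r : S) (e : E), (Ideal.Quotient.mk 𝔄 r) • e = r • e := fun r e => by
    rw [← Ideal.Quotient.algebraMap_eq, algebraMap_smul]
  have hlocal : IsLocalHom (Ideal.Quotient.mk 𝔄) :=
    IsLocalHom.of_surjective _ Ideal.Quotient.mk_surjective
  have hmax : ∀ m : S, m ∈ maximalIdeal S ↔ Ideal.Quotient.mk 𝔄 m ∈ maximalIdeal (S ⧸ 𝔄) :=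
    fun m => by
      rw [mem_maximalIdeal, mem_maximalIdeal, mem_nonunits_iff, mem_nonunits_iff, isUnit_map_iff]
  set ε : E := ι (Submodule.Quotient.mk 1) with hε
  have hrange : ∀ x, ∃ c : S, ι x = c • ε := by
    intro x
    obtain ⟨r, rfl⟩ := Submodule.Quotient.mk_surjective _ x
    obtain ⟨c, rfl⟩ := Ideal.Quotient.mk_surjective r
    refine ⟨c, ?_⟩
    rw [hε, ← hmk, ← map_smul, ← Submodule.Quotient.mk_smul, smul_eq_mul, mul_one]
  have hε0 : ε ≠ 0 := fun h0 => by
    rw [hε, ← map_zero ι, hι.eq_iff, Submodule.Quotient.mk_eq_zero] at h0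
    exact (Ideal.ne_top_iff_one _).mp (Ideal.IsMaximal.ne_top inferInstance) h0
  have hMε : ∀ m ∈ maximalIdeal S, m • ε = 0 := fun m hm => by
    rw [hε, ← hmk, ← map_smul, ← Submodule.Quotient.mk_smul, smul_eq_mul, mul_one,
      (Submodule.Quotient.mk_eq_zero _).mpr ((hmax m).mp hm), map_zero]
  have hmeet : ∀ N : Submodule S E, N ≠ ⊥ → ∃ c : S, c • ε ∈ N ∧ c • ε ≠ 0 := by
    intro N hN
    by_contra! hcon
    let N' : Submodule (S ⧸ 𝔄) E :=
      { N with
        smul_mem' := fun r e he => by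
          obtain ⟨r, rfl⟩ := Ideal.Quotient.mk_surjective r
          rw [hmk]
          exact N.smul_mem r he }
    have hN' : N' = ⊥ := by
      refine hess N' ((Submodule.eq_bot_iff _).mpr ?_)
      rintro _ ⟨he, x, rfl⟩
      obtain ⟨c, hc⟩ := hrange x
      rw [hc]
      refine hcon c ?_
      rw [← hc]
      exact he
    refine hN ((Submodule.eq_bot_iff _).mpr fun e he => ?_)
    have : e ∈ N' := he
    rwa [hN', Submodule.mem_bot] at this
  refine ⟨?_, ?_, ?_, ε, hε0, hMε, ?_⟩
  · intro a ha e
    rw [← hmk, Ideal.Quotient.eq_zero_iff_mem.mpr ha, zero_smul]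
  · intro X Y _ _ _ _ f hf hY g
    have hX : ∀ a ∈ 𝔄, ∀ x : X, a • x = 0 := fun a ha x => hf (by simp [hY a ha])
    have hYt : Module.IsTorsionBySet S Y (𝔄 : Set S) := fun y a => hY a.1 a.2 y
    have hXt : Module.IsTorsionBySet S X (𝔄 : Set S) := fun x a => hX a.1 a.2 x
    let := hYt.module
    let := hXt.module
    let f' : X →ₗ[S ⧸ 𝔄] Y :=
      { f with
        map_smul' := fun r x => by
          obtain ⟨r, rfl⟩ := Ideal.Quotient.mk_surjective r
          exact f.map_smul r x }
    let g' : X →ₗ[S ⧸ 𝔄] E :=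
      { g with
        map_smul' := fun r x => by
          obtain ⟨r, rfl⟩ := Ideal.Quotient.mk_surjective r
          exact (g.map_smul r x).trans (hmk r _).symm }
    obtain ⟨k, hk⟩ := hE.out f' hf g'
    exact ⟨{ k with map_smul' := fun r y => (k.map_smul (Ideal.Quotient.mk 𝔄 r) y).trans (hmk r _) },
      hk⟩
  · intro e
    let F := S ∙ e
    let N : Submodule S F := Submodule.comap F.subtype (S ∙ ε)
    obtain ⟨k, hk⟩ := Ideal.exists_pow_inf_eq_pow_smul (maximalIdeal S) N
    have h1 := hk (k + 1) (by omega)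
    have h2 : maximalIdeal S ^ (k + 1) • (⊤ : Submodule S F) ⊓ N = ⊥ := by
      rw [h1, Nat.add_sub_cancel_left, pow_one, eq_bot_iff]
      refine Submodule.smul_le.mpr fun m hm x hx => ?_
      obtain ⟨c, hc⟩ := Submodule.mem_span_singleton.mp hx.2
      rw [Submodule.mem_bot, Subtype.ext_iff]
      show m • F.subtype x = 0
      rw [← hc, smul_comm, hMε m hm, smul_zero]
    refine ⟨k + 1, fun m hm => ?_⟩
    by_contra hne
    obtain ⟨c, hc, hc0⟩ := hmeet (Submodule.map F.subtype
      (maximalIdeal S ^ (k + 1) • (⊤ : Submodule S F))) (by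
        rw [Submodule.ne_bot_iff]
        exact ⟨m • e, ⟨m • ⟨e, Submodule.mem_span_singleton_self e⟩,
          Submodule.smul_mem_smul hm trivial, rfl⟩, hne⟩)
    obtain ⟨x, hx, hxc⟩ := hc
    have hxN : x ∈ maximalIdeal S ^ (k + 1) • (⊤ : Submodule S F) ⊓ N :=
      ⟨hx, Submodule.mem_span_singleton.mpr ⟨c, hxc.symm⟩⟩
    rw [h2, Submodule.mem_bot] at hxN
    exact hc0 (by rw [← hxc, hxN, map_zero])
  · intro e he
    by_cases he0 : e = 0
    · exact ⟨0, by simp [he0]⟩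
    obtain ⟨c, hc, hc0⟩ := hmeet (S ∙ e) (by simpa using he0)
    obtain ⟨d, hd⟩ := Submodule.mem_span_singleton.mp hc
    have hdu : IsUnit d := by
      by_contra hdu
      exact hc0 (by rw [← hd, he d ((mem_maximalIdeal d).mpr hdu)])
    obtain ⟨d', hd'⟩ := hdu.exists_left_inv
    exact ⟨d' * c, by rw [mul_smul, ← hd, ← mul_smul, hd', one_smul]⟩

variable {𝔄 : Ideal S} {E : Type u} [AddCommGroup E] [Module S E]

theorem Ideal.IsResidueHull.length_torsionBySet_le (hE : 𝔄.IsResidueHull E) (I : Ideal S)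
    (hI : IsFiniteLength S (S ⧸ 𝔄 ⊔ I)) :
    Module.length S (Submodule.torsionBySet S E (I : Set S)) ≤ Module.length S (S ⧸ 𝔄 ⊔ I) := by
  obtain ⟨ε, -, hMε, hsoc⟩ := hE.exists_socle
  have hD : Module.length S (Submodule.torsionBySet S E
      (RingHom.id S '' (maximalIdeal S : Set S))) ≤ 1 := by
    let f : (S ⧸ maximalIdeal S) →ₗ[S] E :=
      Submodule.liftQ _ (LinearMap.toSpanSingleton S E ε) hMε
    have hle : Submodule.torsionBySet S E (RingHom.id S '' (maximalIdeal S : Set S)) ≤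
        LinearMap.range f := by
      intro e he
      obtain ⟨c, rfl⟩ := hsoc e fun m hm => (Submodule.mem_torsionBySet_iff _ _).mp he ⟨m, m, hm, rfl⟩
      exact ⟨Submodule.Quotient.mk c, rfl⟩
    rw [← IsLocalRing.length_quotient_maximalIdeal (S := S)]
    exact (Module.length_le_of_injective _ (Submodule.inclusion_injective hle)).trans
      (Module.length_le_of_surjective _ f.surjective_rangeRestrict)
  let f : Submodule.torsionBySet S E (I : Set S) →ₗ[S] ((S ⧸ 𝔄 ⊔ I) →ₗ[S] E) :=
    { toFun := fun e => Submodule.liftQ _ (LinearMap.toSpanSingleton S E e.1)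
        (sup_le (fun a ha => hE.smul_eq_zero a ha _)
          fun a ha => (Submodule.mem_torsionBySet_iff _ _).mp e.2 ⟨a, ha⟩)
      map_add' := fun d d' => by
        refine Submodule.linearMap_qext _ (LinearMap.ext_ring ?_)
        show (1 : S) • (d + d').1 = (1 : S) • d.1 + (1 : S) • d'.1
        simp
      map_smul' := fun c d => by
        refine Submodule.linearMap_qext _ (LinearMap.ext_ring ?_)
        show (1 : S) • (c • d).1 = c • (1 : S) • d.1
        simp }
  have hf : Function.Injective f := by
    intro d d' hd
    have h1 : (1 : S) • d.1 = (1 : S) • d'.1 :=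
      LinearMap.congr_fun hd (Submodule.Quotient.mk 1)
    rwa [one_smul, one_smul, ← Subtype.ext_iff] at h1
  have := hI.length_semilinearMap_le (RingHom.id S) hD
  rw [one_mul] at this
  exact (Module.length_le_of_injective f hf).trans this

end ResidueHull

section Coordinates

variable {S : Type u} [CommRing S] {s : Finset S} {𝔄 : Ideal S} {E : Type u} [AddCommGroup E]
  [Module S E]

theorem Ideal.mk_mem_torsionBySet_iff (I 𝔄 : Ideal S) (w : S) :
    Submodule.Quotient.mk w ∈ Submodule.torsionBySet S (S ⧸ I) (𝔄 : Set S) ↔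
      ∀ a ∈ 𝔄, a * w ∈ I := by
  simp only [Submodule.mem_torsionBySet_iff, Subtype.forall, SetLike.mem_coe,
    ← Submodule.Quotient.mk_smul, Submodule.Quotient.mk_eq_zero, smul_eq_mul]

/-- Multiplication by the product of the elements of `s`, on the parts killed by `𝔄`. -/
noncomputable def mulProd (h : IsPowRegular s) (𝔄 : Ideal S) (t : ℕ) :
    Submodule.torsionBySet S (S ⧸ Ideal.constPowSpan s t) (𝔄 : Set S) →ₗ[S]
      Submodule.torsionBySet S (S ⧸ Ideal.constPowSpan s (t + 1)) (𝔄 : Set S) :=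
  LinearMap.restrict
    (Submodule.mapQ (Ideal.constPowSpan s t) (Ideal.constPowSpan s (t + 1))
      (LinearMap.mulLeft S (∏ x ∈ s, x)) fun z hz => by
        have := (h.prod_pow_mul_mem_iff t 1).mpr hz
        rwa [pow_one] at this)
    fun z hz => by
      rw [Submodule.mem_torsionBySet_iff] at hz ⊢
      intro a
      rw [← map_smul, hz a, map_zero]

theorem mulProd_injective (h : IsPowRegular s) (𝔄 : Ideal S) (t : ℕ) :
    Function.Injective (mulProd h 𝔄 t) := by
  rw [← LinearMap.ker_eq_bot, LinearMap.ker_eq_bot']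
  rintro ⟨z, hz⟩ hz0
  obtain ⟨z, rfl⟩ := Submodule.Quotient.mk_surjective _ z
  have h1 : (∏ x ∈ s, x) * z ∈ Ideal.constPowSpan s (t + 1) :=
    (Submodule.Quotient.mk_eq_zero _).mp (congrArg Subtype.val hz0)
  rw [← pow_one (∏ x ∈ s, x), h.prod_pow_mul_mem_iff] at h1
  exact Subtype.ext ((Submodule.Quotient.mk_eq_zero _).mpr h1)

variable [IsLocalRing S]

theorem Ideal.IsResidueHull.exists_injective_one (hE : 𝔄.IsResidueHull E)
    (hs : Ideal.span (s : Set S) = maximalIdeal S) :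
    ∃ f : Submodule.torsionBySet S (S ⧸ Ideal.constPowSpan s 1) (𝔄 : Set S) →ₗ[S] E,
      Function.Injective f := by
  obtain ⟨ε, hε, hMε, -⟩ := hE.exists_socle
  refine ⟨(Submodule.liftQ _ (LinearMap.toSpanSingleton S E ε) ?_).comp (Submodule.subtype _), ?_⟩
  · rw [Ideal.constPowSpan_one, hs]
    exact hMε
  · rw [← LinearMap.ker_eq_bot, LinearMap.ker_eq_bot']
    rintro ⟨z, hz⟩ hz0
    obtain ⟨z, rfl⟩ := Submodule.Quotient.mk_surjective _ z
    have h1 : z • ε = 0 := hz0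
    refine Subtype.ext ((Submodule.Quotient.mk_eq_zero _).mpr ?_)
    rw [Ideal.constPowSpan_one, hs]
    by_contra hzu
    have hu : IsUnit z := by
      by_contra hu
      exact hzu ((mem_maximalIdeal z).mpr hu)
    obtain ⟨d, hd⟩ := hu.exists_left_inv
    exact hε (by rw [← one_smul S ε, ← hd, mul_smul, h1, smul_zero])

theorem Ideal.IsResidueHull.exists_injective_succ (hE : 𝔄.IsResidueHull E) (h𝔄 : 𝔄 ≠ ⊤)
    (h : IsPowRegular s) (hs : Ideal.span (s : Set S) = maximalIdeal S) (t : ℕ)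
    (f : Submodule.torsionBySet S (S ⧸ Ideal.constPowSpan s (t + 1)) (𝔄 : Set S) →ₗ[S] E)
    (hf : Function.Injective f) :
    ∃ g : Submodule.torsionBySet S (S ⧸ Ideal.constPowSpan s (t + 1 + 1)) (𝔄 : Set S) →ₗ[S] E,
      Function.Injective g ∧ ∀ z, g (mulProd h 𝔄 (t + 1) z) = f z := by
  obtain ⟨g, hg⟩ := hE.exists_extension _ _ (mulProd h 𝔄 (t + 1)) (mulProd_injective h 𝔄 (t + 1))
    (fun a ha y => Subtype.ext ((Submodule.mem_torsionBySet_iff _ _).mp y.2 ⟨a, ha⟩)) f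
  refine ⟨g, ?_, hg⟩
  rw [← LinearMap.ker_eq_bot, LinearMap.ker_eq_bot']
  rintro ⟨z, hz⟩ hz0
  obtain ⟨z, rfl⟩ := Submodule.Quotient.mk_surjective _ z
  by_contra hne
  have hzP : z ∉ Ideal.constPowSpan s (t + 1 + 1) := fun h0 =>
    hne (Subtype.ext ((Submodule.Quotient.mk_eq_zero _).mpr h0))
  obtain ⟨c, hc⟩ := h.exists_mul_sub_prod_pow_mem hs (t + 1) hzP
  have hπ : Submodule.Quotient.mk ((∏ x ∈ s, x) ^ t) ∈
      Submodule.torsionBySet S (S ⧸ Ideal.constPowSpan s (t + 1)) (𝔄 : Set S) := by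
    rw [Ideal.mk_mem_torsionBySet_iff]
    intro a ha
    rw [mul_comm]
    exact h.prod_pow_mul_mem_of_mem hs t (le_maximalIdeal h𝔄 ha)
  have heq : mulProd h 𝔄 (t + 1) ⟨_, hπ⟩ = c • ⟨Submodule.Quotient.mk z, hz⟩ := by
    refine Subtype.ext (Eq.symm ((Submodule.Quotient.eq _).mpr ?_))
    show c * z - (∏ x ∈ s, x) * (∏ x ∈ s, x) ^ t ∈ _
    rwa [← pow_succ']
  have hzero : f ⟨_, hπ⟩ = 0 := by rw [← hg, heq, map_smul, hz0, smul_zero]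
  rw [← map_zero f, hf.eq_iff] at hzero
  exact h.prod_pow_notMem hs t ((Submodule.Quotient.mk_eq_zero _).mp (congrArg Subtype.val hzero))

theorem Ideal.IsResidueHull.range_eq (hE : 𝔄.IsResidueHull E) (p : ℕ) [Fact p.Prime] [CharP S p]
    (h : IsPowRegular s) (hs : Ideal.span (s : Set S) = maximalIdeal S) (t : ℕ)
    (f : Submodule.torsionBySet S (S ⧸ Ideal.constPowSpan s t) (𝔄 : Set S) →ₗ[S] E)
    (hf : Function.Injective f) :
    LinearMap.range f = Submodule.torsionBySet S E (Ideal.constPowSpan s t : Set S) := by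
  let T := Submodule.torsionBySet S E (Ideal.constPowSpan s t : Set S)
  have hfin : IsFiniteLength S (S ⧸ 𝔄 ⊔ Ideal.constPowSpan s t) := by
    rw [← Module.length_ne_top_iff]
    exact ne_top_of_le_ne_top (Module.length_ne_top_iff.mpr (h.isFiniteLength_quotient hs t))
      (Module.length_le_of_surjective _ (Submodule.factor_surjective (le_sup_right (a := 𝔄))))
  have hlen := hE.length_torsionBySet_le _ hfin
  have hTfin := Module.length_ne_top_iff.mp
    (ne_top_of_le_ne_top (Module.length_ne_top_iff.mpr hfin) hlen)
  obtain ⟨_, _⟩ := isFiniteLength_iff_isNoetherian_isArtinian.mp hTfin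
  let f' : Submodule.torsionBySet S (S ⧸ Ideal.constPowSpan s t) (𝔄 : Set S) →ₗ[S] T := f.codRestrict T (by
    rintro ⟨z, hz⟩
    obtain ⟨z, rfl⟩ := Submodule.Quotient.mk_surjective _ z
    rw [Submodule.mem_torsionBySet_iff]
    rintro ⟨a, ha⟩
    rw [← map_smul, ← map_zero f]
    congr 1
    exact Subtype.ext ((Submodule.Quotient.mk_eq_zero _).mpr (Ideal.mul_mem_right _ _ ha)))
  have hf' : Function.Injective f' := fun x y hxy => hf (congrArg Subtype.val hxy)
  have htop : LinearMap.range f' = ⊤ := by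
    by_contra hne
    have h1 := Submodule.length_lt hne
    rw [← (LinearEquiv.ofInjective f' hf').length_eq, h.length_torsionBySet_quotient_eq hs p t] at h1
    exact (h1.trans_le hlen).false
  ext e
  constructor
  · rintro ⟨x, rfl⟩
    exact (f' x).2
  · intro he
    obtain ⟨x, hx⟩ := LinearMap.range_eq_top.mp htop ⟨e, he⟩
    exact ⟨x, congrArg Subtype.val hx⟩

/-- Compatible coordinates on an injective hull of the residue field of `S ⧸ 𝔄`: the elements
killed by `(x ^ t : x ∈ s)` correspond to `((x ^ t : x ∈ s) : 𝔄) / (x ^ t : x ∈ s)`. -/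
theorem Ideal.IsResidueHull.exists_coordinates (hE : 𝔄.IsResidueHull E) (h𝔄 : 𝔄 ≠ ⊤) (p : ℕ)
    [Fact p.Prime] [CharP S p] (h : IsPowRegular s)
    (hs : Ideal.span (s : Set S) = maximalIdeal S) :
    ∃ θ : ∀ t : ℕ,
      Submodule.torsionBySet S (S ⧸ Ideal.constPowSpan s (t + 1)) (𝔄 : Set S) →ₗ[S] E,
      (∀ t, Function.Injective (θ t)) ∧
      (∀ t, LinearMap.range (θ t) =
        Submodule.torsionBySet S E (Ideal.constPowSpan s (t + 1) : Set S)) ∧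
      ∀ t k (w : S) (hw : ∀ a ∈ 𝔄, a * w ∈ Ideal.constPowSpan s (t + 1))
        (hw' : ∀ a ∈ 𝔄, a * ((∏ x ∈ s, x) ^ k * w) ∈ Ideal.constPowSpan s (t + k + 1)),
        θ (t + k) ⟨Submodule.Quotient.mk ((∏ x ∈ s, x) ^ k * w),
            (Ideal.mk_mem_torsionBySet_iff _ _ _).mpr hw'⟩ =
          θ t ⟨Submodule.Quotient.mk w, (Ideal.mk_mem_torsionBySet_iff _ _ _).mpr hw⟩ := by
  obtain ⟨f₁, hf₁⟩ := hE.exists_injective_one hs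
  choose F hF hFμ using fun t f hf => hE.exists_injective_succ h𝔄 h hs t f hf
  let G : ∀ t : ℕ, { f : Submodule.torsionBySet S (S ⧸ Ideal.constPowSpan s (t + 1))
      (𝔄 : Set S) →ₗ[S] E // Function.Injective f } := fun t =>
    Nat.rec ⟨f₁, hf₁⟩ (fun t f => ⟨F t f.1 f.2, hF t f.1 f.2⟩) t
  refine ⟨fun t => (G t).1, fun t => (G t).2, fun t => hE.range_eq p h hs (t + 1) _ (G t).2, ?_⟩
  intro t k
  induction k with
  | zero =>
    intro w hw hw'
    congr 2
    simp
  | succ k ih =>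
    intro w hw hw'
    have hw'' : ∀ a ∈ 𝔄, a * ((∏ x ∈ s, x) ^ k * w) ∈ Ideal.constPowSpan s (t + k + 1) := by
      intro a ha
      rw [mul_left_comm, add_right_comm, h.prod_pow_mul_mem_iff]
      exact hw a ha
    rw [← ih w hw hw'', ← hFμ (t + k) (G (t + k)).1 (G (t + k)).2]
    show F (t + k) (G (t + k)).1 (G (t + k)).2 _ = _
    congr 2
    show (Submodule.Quotient.mk _ : S ⧸ Ideal.constPowSpan s (t + k + 1 + 1)) =
      Submodule.Quotient.mk ((∏ x ∈ s, x) * ((∏ x ∈ s, x) ^ k * w))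
    rw [pow_succ', mul_assoc]

end Coordinates

section TensorCriterion

variable {R : Type u} {p n : ℕ} [CommRing R] [Fact p.Prime] [CharP R p] {E : Type u}
  [AddCommGroup E] [Module R E]

theorem FrobAlg.algebraMap_apply (r : R) :
    algebraMap R (FrobAlg R p n) r = FrobAlg.of R p n (r ^ p ^ n) := by
  show ((frobenius R p) ^ n) r = r ^ p ^ n
  induction n generalizing r with
  | zero => simp
  | succ n ih =>
    rw [pow_succ, RingHom.mul_def, RingHom.comp_apply, ih, frobenius_def, ← pow_mul, pow_succ']

theorem FrobBC.tmul_smul (r c : R) (e : E) :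
    FrobBC.tmul R p n r (c • e) = FrobBC.tmul R p n (c ^ p ^ n * r) e := by
  show FrobAlg.of R p n r ⊗ₜ[R] (c • e) = FrobAlg.of R p n (c ^ p ^ n * r) ⊗ₜ[R] e
  rw [← TensorProduct.smul_tmul, Algebra.smul_def, FrobAlg.algebraMap_apply]
  rfl

theorem FrobBC.smul_tmul (r c : R) (e : E) :
    r • FrobBC.tmul R p n c e = FrobBC.tmul R p n (r * c) e :=
  rfl

theorem FrobBC.tmul_add (r : R) (e e' : E) :
    FrobBC.tmul R p n r (e + e') = FrobBC.tmul R p n r e + FrobBC.tmul R p n r e' :=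
  TensorProduct.tmul_add _ _ _

theorem FrobBC.smul_apply_eq_zero (ψ : E →+ E) (hψ : ∀ (c : R) e, ψ (c • e) = c ^ p ^ n • ψ e)
    {r : R} {e : E} (h : FrobBC.tmul R p n r e = 0) : r • ψ e = 0 := by
  let g : FrobAlg R p n →+ E →+ E :=
    { toFun := fun r => (DistribSMul.toAddMonoidHom E (show R from r)).comp ψ
      map_zero' := by ext e; exact zero_smul R _
      map_add' := fun a b => by ext e; exact add_smul (show R from a) (show R from b) _ }
  let L : FrobAlg R p n ⊗[R] E →+ E := TensorProduct.liftAddHom g fun c a e => by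
    rw [Algebra.smul_def, FrobAlg.algebraMap_apply]
    show (c ^ p ^ n * (show R from a)) • ψ e = (show R from a) • ψ (c • e)
    rw [hψ, mul_comm, mul_smul]
  have h1 : L (FrobAlg.of R p n r ⊗ₜ[R] e) = 0 := (congrArg L h).trans (map_zero L)
  exact h1

theorem Module.Injective.exists_apply_ne_zero [IsLocalRing R] (hE : Module.Injective R E)
    (ι : (R ⧸ maximalIdeal R) →ₗ[R] E) (hι : Function.Injective ι)
    {X : Type u} [AddCommGroup X] [Module R X] {z : X} (hz : z ≠ 0) :
    ∃ g : X →ₗ[R] E, g z ≠ 0 := by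
  have hle : LinearMap.ker (LinearMap.toSpanSingleton R X z) ≤ maximalIdeal R := by
    refine le_maximalIdeal fun htop => hz ?_
    have h1 : (1 : R) ∈ LinearMap.ker (LinearMap.toSpanSingleton R X z) := htop ▸ trivial
    simpa using h1
  obtain ⟨g, hg⟩ := hE.out
    ((LinearMap.ker (LinearMap.toSpanSingleton R X z)).liftQ _ le_rfl)
    (LinearMap.ker_eq_bot.mp (Submodule.ker_liftQ_eq_bot' _ _ rfl))
    (ι.comp (Submodule.factor hle))
  refine ⟨g, ?_⟩
  have h1 := hg (Submodule.Quotient.mk 1)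
  have h2 : g ((1 : R) • z) = ι (Submodule.Quotient.mk 1) := h1
  rw [one_smul] at h2
  rw [h2]
  intro h0
  rw [← map_zero ι, hι.eq_iff, Submodule.Quotient.mk_eq_zero] at h0
  exact (Ideal.ne_top_iff_one _).mp (Ideal.IsMaximal.ne_top inferInstance) h0

theorem FrobBC.exists_smul_apply_ne_zero [IsLocalRing R] (hE : Module.Injective R E)
    (ι : (R ⧸ maximalIdeal R) →ₗ[R] E) (hι : Function.Injective ι) {r : R} {e : E}
    (h : FrobBC.tmul R p n r e ≠ 0) :
    ∃ ψ : E →+ E, (∀ (c : R) e, ψ (c • e) = c ^ p ^ n • ψ e) ∧ r • ψ e ≠ 0 := by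
  obtain ⟨g, hg⟩ := hE.exists_apply_ne_zero ι hι h
  refine ⟨AddMonoidHom.mk' (fun e => g (FrobBC.tmul R p n 1 e)) fun e e' => ?_, fun c e => ?_, ?_⟩
  · rw [FrobBC.tmul_add, map_add]
  · show g _ = _ • g _
    rw [FrobBC.tmul_smul, ← map_smul, FrobBC.smul_tmul]
  · show r • g _ ≠ 0
    rwa [← map_smul, FrobBC.smul_tmul, mul_one]

end TensorCriterion

section ArtinRees

variable {S : Type u} [CommRing S] [IsNoetherianRing S]

theorem Ideal.exists_sub_mem_pow_of_mul_mem_sup (M I J : Ideal S) (N : ℕ) :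
    ∃ T, ∀ t, T ≤ t → ∀ u, (∀ a ∈ I, u * a ∈ J ⊔ M ^ t) →
      ∃ u', (∀ a ∈ I, u' * a ∈ J) ∧ u - u' ∈ M ^ N := by
  classical
  obtain ⟨g, hg⟩ := (isNoetherian_def.mp ‹IsNoetherianRing S›) I
  let L : S →ₗ[S] (g → S ⧸ J) :=
    LinearMap.pi fun a => J.mkQ.comp (LinearMap.mulRight S a.1)
  obtain ⟨k, hk⟩ := Ideal.exists_pow_inf_eq_pow_smul M (LinearMap.range L)
  refine ⟨k + N, fun t ht u hu => ?_⟩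
  have hLu : L u ∈ M ^ t • (⊤ : Submodule S (g → S ⧸ J)) := by
    rw [← Finset.univ_sum_single (L u)]
    refine Submodule.sum_mem _ fun a _ => ?_
    have h1 : L u a ∈ M ^ t • (⊤ : Submodule S (S ⧸ J)) := by
      obtain ⟨b, hb, c, hc, hbc⟩ := Submodule.mem_sup.mp
        (hu a.1 (hg ▸ Submodule.subset_span a.2))
      have h2 : L u a = c • (Submodule.Quotient.mk 1 : S ⧸ J) := by
        rw [← Submodule.Quotient.mk_smul, smul_eq_mul, mul_one]
        refine (Submodule.Quotient.eq _).mpr ?_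
        show u * a.1 - c ∈ J
        rwa [← hbc, add_sub_cancel_right]
      rw [h2]
      exact Submodule.smul_mem_smul hc trivial
    exact Submodule.smul_top_le_comap_smul_top (M ^ t) (LinearMap.single S (fun _ => S ⧸ J) a) h1
  have hmem : L u ∈ M ^ t • ⊤ ⊓ LinearMap.range L := ⟨hLu, u, rfl⟩
  rw [hk t (by omega)] at hmem
  have hmem' : L u ∈ M ^ N • LinearMap.range L :=
    Submodule.smul_mono (Ideal.pow_le_pow_right (by omega)) inf_le_right hmem
  rw [← Submodule.map_top, ← Submodule.map_smul''] at hmem'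
  obtain ⟨m, hm, hLm⟩ := hmem'
  refine ⟨u - m, ?_, by simpa using hm⟩
  intro a ha
  have hker : L (u - m) = 0 := by rw [map_sub, hLm, sub_self]
  have hgJ : I ≤ Submodule.comap (LinearMap.mulLeft S (u - m)) J := by
    rw [← hg]
    refine Submodule.span_le.mpr fun b hb => ?_
    have h3 : (u - m) * b ∈ J := (Submodule.Quotient.mk_eq_zero J).mp (congrFun hker ⟨b, hb⟩)
    exact h3
  exact hgJ ha

theorem Ideal.mem_of_forall_mem_sup_pow [IsLocalRing S] (J : Ideal S) {z : S}
    (hz : ∀ t, z ∈ J ⊔ maximalIdeal S ^ t) : z ∈ J := by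
  rw [← Submodule.Quotient.mk_eq_zero, ← Submodule.mem_bot S,
    ← Ideal.iInf_pow_smul_eq_bot_of_isLocalRing (M := S ⧸ J) (maximalIdeal S)
      (Ideal.IsMaximal.ne_top inferInstance), Submodule.mem_iInf]
  intro t
  obtain ⟨b, hb, c, hc, hbc⟩ := Submodule.mem_sup.mp (hz t)
  have h2 : (Submodule.Quotient.mk z : S ⧸ J) = c • (Submodule.Quotient.mk 1 : S ⧸ J) := by
    rw [← Submodule.Quotient.mk_smul, smul_eq_mul, mul_one]
    refine (Submodule.Quotient.eq _).mpr ?_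
    rwa [← hbc, add_sub_cancel_right]
  rw [h2]
  exact Submodule.smul_mem_smul hc trivial

end ArtinRees

section HullCoordinates

variable {S : Type u} [CommRing S] {s : Finset S} {𝔄 : Ideal S} {E : Type u}
  [AddCommGroup E] [Module S E]

/-- Functions `θ t : S → E`, meaningful on `((x ^ t : x ∈ s) : 𝔄)` for positive `t`, that identify
`((x ^ t : x ∈ s) : 𝔄) / (x ^ t : x ∈ s)` with the elements of `E` killed by `(x ^ t : x ∈ s)`. -/
structure HullCoordinates (s : Finset S) (𝔄 : Ideal S) (E : Type u) [AddCommGroup E]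
    [Module S E] where
  θ : ℕ → S → E
  map_add {t : ℕ} {w w' : S} : (∀ a ∈ 𝔄, a * w ∈ Ideal.constPowSpan s t) →
    (∀ a ∈ 𝔄, a * w' ∈ Ideal.constPowSpan s t) → θ t (w + w') = θ t w + θ t w'
  map_mul {t : ℕ} (c : S) {w : S} : (∀ a ∈ 𝔄, a * w ∈ Ideal.constPowSpan s t) →
    θ t (c * w) = c • θ t w
  eq_zero_iff {t : ℕ} {w : S} : 1 ≤ t → (∀ a ∈ 𝔄, a * w ∈ Ideal.constPowSpan s t) →
    (θ t w = 0 ↔ w ∈ Ideal.constPowSpan s t)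
  exists_eq {t : ℕ} {e : E} : 1 ≤ t → (∀ a ∈ Ideal.constPowSpan s t, a • e = 0) →
    ∃ w, (∀ a ∈ 𝔄, a * w ∈ Ideal.constPowSpan s t) ∧ θ t w = e
  prod_pow_mul {t : ℕ} (k : ℕ) {w : S} : 1 ≤ t → (∀ a ∈ 𝔄, a * w ∈ Ideal.constPowSpan s t) →
    θ (t + k) ((∏ x ∈ s, x) ^ k * w) = θ t w

theorem Ideal.IsResidueHull.nonempty_hullCoordinates [IsLocalRing S] (hE : 𝔄.IsResidueHull E) (h𝔄 : 𝔄 ≠ ⊤) (p : ℕ)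
    [Fact p.Prime] [CharP S p] (h : IsPowRegular s)
    (hs : Ideal.span (s : Set S) = maximalIdeal S) : Nonempty (HullCoordinates s 𝔄 E) := by
  classical
  obtain ⟨θ, hinj, hrange, hcompat⟩ := hE.exists_coordinates h𝔄 p h hs
  let Θ : ℕ → S → E := fun t w =>
    match t with
    | 0 => 0
    | t + 1 => if hw : ∀ a ∈ 𝔄, a * w ∈ Ideal.constPowSpan s (t + 1) then
        θ t ⟨Submodule.Quotient.mk w, (Ideal.mk_mem_torsionBySet_iff _ _ _).mpr hw⟩ else 0
  have hΘ : ∀ t w (hw : ∀ a ∈ 𝔄, a * w ∈ Ideal.constPowSpan s (t + 1)), Θ (t + 1) w =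
      θ t ⟨Submodule.Quotient.mk w, (Ideal.mk_mem_torsionBySet_iff _ _ _).mpr hw⟩ :=
    fun t w hw => dif_pos hw
  refine ⟨⟨Θ, ?_, ?_, ?_, ?_, ?_⟩⟩
  · intro t w w' hw hw'
    cases t with
    | zero => exact (add_zero (0 : E)).symm
    | succ t =>
      rw [hΘ t w hw, hΘ t w' hw', hΘ t (w + w') fun a ha => by
        rw [mul_add]; exact Ideal.add_mem _ (hw a ha) (hw' a ha), ← _root_.map_add]
      rfl
  · intro t c w hw
    cases t with
    | zero => exact (smul_zero c).symm
    | succ t =>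
      rw [hΘ t w hw, hΘ t (c * w) fun a ha => by
        rw [mul_left_comm]; exact Ideal.mul_mem_left _ _ (hw a ha), ← map_smul]
      rfl
  · intro t w ht hw
    obtain ⟨t, rfl⟩ := Nat.exists_eq_succ_of_ne_zero (Nat.one_le_iff_ne_zero.mp ht)
    rw [hΘ t w hw, ← map_zero (θ t), (hinj t).eq_iff, Subtype.ext_iff]
    exact Submodule.Quotient.mk_eq_zero _
  · intro t e ht he
    obtain ⟨t, rfl⟩ := Nat.exists_eq_succ_of_ne_zero (Nat.one_le_iff_ne_zero.mp ht)
    have hmem : e ∈ LinearMap.range (θ t) := by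
      rw [hrange, Submodule.mem_torsionBySet_iff]
      exact fun a => he a.1 a.2
    obtain ⟨⟨w, hw⟩, rfl⟩ := hmem
    obtain ⟨w, rfl⟩ := Submodule.Quotient.mk_surjective _ w
    exact ⟨w, (Ideal.mk_mem_torsionBySet_iff _ _ _).mp hw,
      hΘ t w ((Ideal.mk_mem_torsionBySet_iff _ _ _).mp hw)⟩
  · intro t k w ht hw
    obtain ⟨t, rfl⟩ := Nat.exists_eq_succ_of_ne_zero (Nat.one_le_iff_ne_zero.mp ht)
    have hw' : ∀ a ∈ 𝔄, a * ((∏ x ∈ s, x) ^ k * w) ∈ Ideal.constPowSpan s (t + k + 1) := by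
      intro a ha
      rw [mul_left_comm, add_right_comm, h.prod_pow_mul_mem_iff]
      exact hw a ha
    have h1 : t.succ + k = t + k + 1 := by omega
    rw [h1, hΘ _ _ hw', hcompat t k w hw hw', hΘ t w hw]

namespace HullCoordinates

theorem mul_mem_mul_left {t : ℕ} (c : S) {w : S} (hw : ∀ a ∈ 𝔄, a * w ∈ Ideal.constPowSpan s t) :
    ∀ a ∈ 𝔄, a * (c * w) ∈ Ideal.constPowSpan s t := fun a ha => by
  rw [mul_left_comm]
  exact Ideal.mul_mem_left _ _ (hw a ha)

theorem mul_mem_prod_pow (h : IsPowRegular s) {t : ℕ} (k : ℕ) {w : S}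
    (hw : ∀ a ∈ 𝔄, a * w ∈ Ideal.constPowSpan s t) :
    ∀ a ∈ 𝔄, a * ((∏ x ∈ s, x) ^ k * w) ∈ Ideal.constPowSpan s (t + k) := fun a ha => by
  rw [mul_left_comm, h.prod_pow_mul_mem_iff]
  exact hw a ha

variable (H : HullCoordinates s 𝔄 E)

theorem map_sub {t : ℕ} {w w' : S} (hw : ∀ a ∈ 𝔄, a * w ∈ Ideal.constPowSpan s t)
    (hw' : ∀ a ∈ 𝔄, a * w' ∈ Ideal.constPowSpan s t) :
    H.θ t (w - w') = H.θ t w - H.θ t w' := by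
  have h1 : w - w' = w + (-1) * w' := by ring
  rw [h1, H.map_add hw (mul_mem_mul_left _ hw'), H.map_mul _ hw', neg_one_smul, sub_eq_add_neg]

theorem eq_iff {t : ℕ} {w w' : S} (ht : 1 ≤ t) (hw : ∀ a ∈ 𝔄, a * w ∈ Ideal.constPowSpan s t)
    (hw' : ∀ a ∈ 𝔄, a * w' ∈ Ideal.constPowSpan s t) :
    H.θ t w = H.θ t w' ↔ w - w' ∈ Ideal.constPowSpan s t := by
  rw [← sub_eq_zero, ← H.map_sub hw hw', H.eq_zero_iff ht]
  intro a ha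
  rw [mul_sub]
  exact Ideal.sub_mem _ (hw a ha) (hw' a ha)

theorem smul_eq_zero_iff {t : ℕ} {w : S} (ht : 1 ≤ t)
    (hw : ∀ a ∈ 𝔄, a * w ∈ Ideal.constPowSpan s t) (c : S) :
    c • H.θ t w = 0 ↔ c * w ∈ Ideal.constPowSpan s t := by
  rw [← H.map_mul c hw, H.eq_zero_iff ht (mul_mem_mul_left c hw)]

theorem exists_rep [IsLocalRing S] (hs : Ideal.span (s : Set S) = maximalIdeal S)
    (hE : 𝔄.IsResidueHull E) (e : E) :
    ∃ t w, 1 ≤ t ∧ (∀ a ∈ 𝔄, a * w ∈ Ideal.constPowSpan s t) ∧ H.θ t w = e := by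
  obtain ⟨N, hN⟩ := hE.exists_pow_smul_eq_zero e
  obtain ⟨w, hw, hwe⟩ := H.exists_eq (t := N + 1) (e := e) (by omega) fun a ha =>
    hN a (Ideal.pow_le_pow_right (Nat.le_succ N) (hs ▸ Ideal.constPowSpan_le_pow _ ha))
  exact ⟨N + 1, w, by omega, hw, hwe⟩

theorem mul_pow_sub_mem (p n : ℕ) [Fact p.Prime] [CharP S p] {t : ℕ} {w w' : S} (u : S)
    (hw : w - w' ∈ Ideal.constPowSpan s t) :
    u * w ^ p ^ n - u * w' ^ p ^ n ∈ Ideal.constPowSpan s (t * p ^ n) := by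
  rw [← mul_sub, ← sub_pow_char_pow, ← Ideal.bracketPow_constPowSpan]
  exact Ideal.mul_mem_left _ _ (Ideal.subset_span ⟨_, hw, rfl⟩)

theorem mul_pow_mem_of_mem_bracketPow (p n : ℕ) [Fact p.Prime] [CharP S p] {t : ℕ} {B : Ideal S}
    {w b : S} (hw : ∀ a ∈ B, a * w ∈ Ideal.constPowSpan s t) (hb : b ∈ B.bracketPow (p ^ n)) :
    b * w ^ p ^ n ∈ Ideal.constPowSpan s (t * p ^ n) := by
  have hle : B.bracketPow (p ^ n) ≤
      Submodule.comap (LinearMap.mulRight S (w ^ p ^ n)) (Ideal.constPowSpan s (t * p ^ n)) := by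
    refine Ideal.span_le.mpr ?_
    rintro _ ⟨a, ha, rfl⟩
    show a ^ p ^ n * w ^ p ^ n ∈ Ideal.constPowSpan s (t * p ^ n)
    rw [← mul_pow, ← Ideal.bracketPow_constPowSpan]
    exact Ideal.subset_span ⟨_, hw a ha, rfl⟩
  exact hle hb

/-- A multiplier `u` with `u 𝔄 ⊆ 𝔄^[q]` induces a Frobenius-semilinear endomorphism of the hull. -/
theorem exists_semilinear [IsLocalRing S] (p n : ℕ) [Fact p.Prime] [CharP S p] (h : IsPowRegular s)
    (hs : Ideal.span (s : Set S) = maximalIdeal S) (hE : 𝔄.IsResidueHull E) {u : S}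
    (hu : ∀ a ∈ 𝔄, u * a ∈ 𝔄.bracketPow (p ^ n)) :
    ∃ ψ : E →+ E, (∀ (c : S) e, ψ (c • e) = c ^ p ^ n • ψ e) ∧
      ∀ t w, 1 ≤ t → (∀ a ∈ 𝔄, a * w ∈ Ideal.constPowSpan s t) →
        ψ (H.θ t w) = H.θ (t * p ^ n) (u * w ^ p ^ n) := by
  have hq : 1 ≤ p ^ n := Nat.one_le_pow _ _ (Fact.out : p.Prime).pos
  have hcol : ∀ {t : ℕ} {w : S}, (∀ a ∈ 𝔄, a * w ∈ Ideal.constPowSpan s t) →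
      ∀ a ∈ 𝔄, a * (u * w ^ p ^ n) ∈ Ideal.constPowSpan s (t * p ^ n) := fun hw a ha => by
    rw [← mul_assoc, mul_comm a u]
    exact mul_pow_mem_of_mem_bracketPow p n hw (hu a ha)
  have hshift : ∀ {t : ℕ} {w : S} (k : ℕ), 1 ≤ t → (∀ a ∈ 𝔄, a * w ∈ Ideal.constPowSpan s t) →
      H.θ ((t + k) * p ^ n) (u * ((∏ x ∈ s, x) ^ k * w) ^ p ^ n) =
        H.θ (t * p ^ n) (u * w ^ p ^ n) := fun {t w} k ht hw => by
    rw [← H.prod_pow_mul (k * p ^ n) (Nat.mul_pos ht hq) (hcol hw), add_mul]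
    congr 1
    ring
  have hcongr : ∀ {t : ℕ} {w : S} {t' : ℕ} {w' : S}, 1 ≤ t → 1 ≤ t' → (∀ a ∈ 𝔄, a * w ∈ Ideal.constPowSpan s t) →
      (∀ a ∈ 𝔄, a * w' ∈ Ideal.constPowSpan s t') → H.θ t w = H.θ t' w' →
      H.θ (t * p ^ n) (u * w ^ p ^ n) = H.θ (t' * p ^ n) (u * w' ^ p ^ n) := by
    intro t w t' w' ht ht' hw hw' heq
    have hw1 := mul_mem_prod_pow h t' hw
    have hw1' := mul_mem_prod_pow h t hw'
    rw [add_comm] at hw1'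
    rw [← H.prod_pow_mul t' ht hw, ← H.prod_pow_mul t ht' hw', add_comm t' t,
      H.eq_iff (by omega) hw1 hw1'] at heq
    rw [← hshift t' ht hw, ← hshift t ht' hw', add_comm t' t,
      H.eq_iff (Nat.mul_pos (by omega) hq) (hcol hw1) (hcol hw1')]
    exact mul_pow_sub_mem p n u heq
  choose T W hT hW hTW using H.exists_rep hs hE
  have hval : ∀ t w, 1 ≤ t → (∀ a ∈ 𝔄, a * w ∈ Ideal.constPowSpan s t) →
      H.θ (T (H.θ t w) * p ^ n) (u * W (H.θ t w) ^ p ^ n) =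
        H.θ (t * p ^ n) (u * w ^ p ^ n) := fun t w ht hw =>
    hcongr (hT _) ht (hW _) hw (hTW _)
  refine ⟨AddMonoidHom.mk' (fun e => H.θ (T e * p ^ n) (u * W e ^ p ^ n)) fun e e' => ?_, ?_, hval⟩
  · have hw := mul_mem_prod_pow h (T e') (hW e)
    have hw' := mul_mem_prod_pow h (T e) (hW e')
    rw [add_comm] at hw'
    have hsum : H.θ (T e + T e') ((∏ x ∈ s, x) ^ T e' * W e + (∏ x ∈ s, x) ^ T e * W e') =
        e + e' := by
      rw [H.map_add hw hw', H.prod_pow_mul _ (hT e) (hW e), add_comm (T e),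
        H.prod_pow_mul _ (hT e') (hW e'), hTW, hTW]
    have hpos : 1 ≤ T e + T e' := (hT e).trans (Nat.le_add_right _ _)
    have h1 := hval (T e + T e') ((∏ x ∈ s, x) ^ T e' * W e + (∏ x ∈ s, x) ^ T e * W e') hpos
      fun a ha => by
        rw [mul_add]
        exact Ideal.add_mem _ (hw a ha) (hw' a ha)
    rw [hsum] at h1
    rw [h1, add_pow_char_pow, mul_add, H.map_add (hcol hw) (hcol hw'), hshift _ (hT e) (hW e),
      add_comm (T e), hshift _ (hT e') (hW e')]
  · intro c e
    show H.θ _ _ = _ • H.θ _ _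
    have h1 := hval (T e) (c * W e) (hT e) (mul_mem_mul_left c (hW e))
    rw [H.map_mul c (hW e), hTW] at h1
    rw [h1, ← H.map_mul _ (hcol (hW e))]
    congr 1
    ring

/-- Every Frobenius-semilinear endomorphism of the hull is, on the elements killed by
`(x ^ t : x ∈ s)`, given by a multiplier. -/
theorem exists_multiplier [IsLocalRing S] (p n : ℕ) [Fact p.Prime] [CharP S p] (h : IsPowRegular s)
    (hs : Ideal.span (s : Set S) = maximalIdeal S) (ψ : E →+ E)
    (hψ : ∀ (c : S) e, ψ (c • e) = c ^ p ^ n • ψ e) {t : ℕ} (ht : 1 ≤ t) :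
    ∃ u : S, ∀ w, (∀ a ∈ 𝔄, a * w ∈ Ideal.constPowSpan s t) →
      (∀ a ∈ 𝔄, a * (u * w ^ p ^ n) ∈ Ideal.constPowSpan s (t * p ^ n)) ∧
        ψ (H.θ t w) = H.θ (t * p ^ n) (u * w ^ p ^ n) := by
  have hq : 1 ≤ p ^ n := Nat.one_le_pow _ _ (Fact.out : p.Prime).pos
  have htq : 1 ≤ t * p ^ n := Nat.mul_pos ht hq
  have hex : ∀ w, ∃ v, (∀ a ∈ 𝔄, a * w ∈ Ideal.constPowSpan s t) →
      (∀ a ∈ 𝔄, a * v ∈ Ideal.constPowSpan s (t * p ^ n)) ∧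
        H.θ (t * p ^ n) v = ψ (H.θ t w) := by
    intro w
    by_cases hw : ∀ a ∈ 𝔄, a * w ∈ Ideal.constPowSpan s t
    · have hkill : Ideal.constPowSpan s (t * p ^ n) ≤
          LinearMap.ker (LinearMap.toSpanSingleton S E (ψ (H.θ t w))) := by
        refine Ideal.span_le.mpr ?_
        rintro _ ⟨x, hx, rfl⟩
        show x ^ (t * p ^ n) • ψ (H.θ t w) = 0
        rw [pow_mul, ← hψ, (H.smul_eq_zero_iff ht hw _).mpr, map_zero]
        exact Ideal.mul_mem_right _ _ (Ideal.subset_span ⟨x, hx, rfl⟩)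
      obtain ⟨v, hv⟩ := H.exists_eq htq fun a ha => hkill ha
      exact ⟨v, fun _ => hv⟩
    · exact ⟨0, fun h0 => absurd h0 hw⟩
  choose V hV using hex
  have hcol := Ideal.mk_mem_torsionBySet_iff (Ideal.constPowSpan s t) 𝔄
  let K := Submodule.torsionBySet S (S ⧸ Ideal.constPowSpan s t) (𝔄 : Set S)
  have hcongr : ∀ v w, (∀ a ∈ 𝔄, a * v ∈ Ideal.constPowSpan s t) →
      (∀ a ∈ 𝔄, a * w ∈ Ideal.constPowSpan s t) → v - w ∈ Ideal.constPowSpan s t →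
      (Submodule.Quotient.mk (V v) : S ⧸ Ideal.constPowSpan s (t * p ^ n)) =
        Submodule.Quotient.mk (V w) := by
    intro v w hv hw hvw
    rw [Submodule.Quotient.eq, ← H.eq_iff htq (hV v hv).1 (hV w hw).1, (hV v hv).2, (hV w hw).2,
      (H.eq_iff ht hv hw).mpr hvw]
  let rep : K → S := fun z => (Submodule.Quotient.mk_surjective _ z.1).choose
  have hrep : ∀ z : K, Submodule.Quotient.mk (rep z) = z.1 := fun z =>
    (Submodule.Quotient.mk_surjective _ z.1).choose_spec
  have hrepc : ∀ z : K, ∀ a ∈ 𝔄, a * rep z ∈ Ideal.constPowSpan s t := fun z =>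
    (hcol _).mp (by rw [hrep]; exact z.2)
  let f : K →ₛₗ[iterateFrobenius S p n] S ⧸ Ideal.constPowSpan s (t * p ^ n) :=
    { toFun := fun z => Submodule.Quotient.mk (V (rep z))
      map_add' := fun z z' => by
        have hadd : ∀ a ∈ 𝔄, a * (rep z + rep z') ∈ Ideal.constPowSpan s t := fun a ha => by
          rw [mul_add]
          exact Ideal.add_mem _ (hrepc z a ha) (hrepc z' a ha)
        rw [hcongr _ _ (hrepc _) hadd (by
          rw [← Submodule.Quotient.eq, Submodule.Quotient.mk_add, hrep, hrep, hrep]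
          rfl), ← Submodule.Quotient.mk_add, Submodule.Quotient.eq,
          ← H.eq_iff htq (hV _ hadd).1 fun a ha => by
            rw [mul_add]
            exact Ideal.add_mem _ ((hV _ (hrepc z)).1 a ha) ((hV _ (hrepc z')).1 a ha),
          (hV _ hadd).2, H.map_add (hV _ (hrepc z)).1 (hV _ (hrepc z')).1,
          (hV _ (hrepc z)).2, (hV _ (hrepc z')).2, H.map_add (hrepc z) (hrepc z'),
          _root_.map_add]
      map_smul' := fun c z => by
        have hmul := mul_mem_mul_left c (hrepc z)
        rw [hcongr _ _ (hrepc _) hmul (by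
          rw [← Submodule.Quotient.eq, ← smul_eq_mul, Submodule.Quotient.mk_smul, hrep, hrep]
          rfl), ← Submodule.Quotient.mk_smul, Submodule.Quotient.eq, smul_eq_mul,
          ← H.eq_iff htq (hV _ hmul).1 (mul_mem_mul_left _ (hV _ (hrepc z)).1),
          (hV _ hmul).2, H.map_mul _ (hV _ (hrepc z)).1, (hV _ (hrepc z)).2,
          H.map_mul _ (hrepc z), hψ]
        rfl }
  obtain ⟨u, hu⟩ := h.exists_semilinearMap_eq p n hs t K f
  refine ⟨u, fun w hw => ?_⟩
  have h1 := hu w ((hcol w).mpr hw)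
  have h2 : (Submodule.Quotient.mk (V w) : S ⧸ Ideal.constPowSpan s (t * p ^ n)) =
      Submodule.Quotient.mk (u * w ^ p ^ n) := by
    rw [← h1]
    refine hcongr _ _ hw (hrepc _) ?_
    rw [← Submodule.Quotient.eq, hrep]
  rw [Submodule.Quotient.eq] at h2
  have h3 : ∀ a ∈ 𝔄, a * (u * w ^ p ^ n) ∈ Ideal.constPowSpan s (t * p ^ n) := fun a ha => by
    have h4 := Ideal.sub_mem _ ((hV w hw).1 a ha) (Ideal.mul_mem_left _ a h2)
    rwa [← mul_sub, sub_sub_cancel] at h4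
  exact ⟨h3, by rw [← (hV w hw).2, H.eq_iff htq (hV w hw).1 h3]; exact h2⟩

end HullCoordinates

end HullCoordinates

theorem fully_special_iff_colon_bracket_pow (S : Type u) [CommRing S] [IsNoetherianRing S] [IsLocalRing S]
    (p : ℕ) [Fact p.Prime] [CharP S p] (hreg : IsRegularLocal S)
    (𝔄 : Ideal S) (h𝔄 : 𝔄 ≠ ⊤)
    [IsLocalRing (S ⧸ 𝔄)] [CharP (S ⧸ 𝔄) p]
    (E : Type u) [AddCommGroup E] [Module (S ⧸ 𝔄) E]
    (hE : Module.Injective (S ⧸ 𝔄) E)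
    (ι : ((S ⧸ 𝔄) ⧸ maximalIdeal (S ⧸ 𝔄)) →ₗ[S ⧸ 𝔄] E) (hι : Function.Injective ι)
    (hess : ∀ N : Submodule (S ⧸ 𝔄) E, N ⊓ LinearMap.range ι = ⊥ → N = ⊥)
    (hFpure : IsFPure (S ⧸ 𝔄) p)
    (𝔟 : Ideal (S ⧸ 𝔄)) (h𝔟 : 𝔟 ≠ ⊤)
    (𝔅 : Ideal S) (h1 : 𝔄 ≤ 𝔅) (h2 : 𝔅.map (Ideal.Quotient.mk 𝔄) = 𝔟) :
    IsFullyPhiSpecial (S ⧸ 𝔄) p E 𝔟 ↔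
      ∀ n : ℕ, 1 ≤ n →
        Submodule.colon (Ideal.bracketPow 𝔄 (p ^ n)) 𝔄 ≤
          Submodule.colon (Ideal.bracketPow 𝔅 (p ^ n)) 𝔅 := by
  obtain ⟨s, hs, h⟩ := hreg.exists_isPowRegular
  let : Module S E := Module.compHom E (Ideal.Quotient.mk 𝔄)
  have : IsScalarTower S (S ⧸ 𝔄) E := IsScalarTower.of_algebraMap_smul fun _ _ => rfl
  have hmk : ∀ (c : S) (e : E), Ideal.Quotient.mk 𝔄 c • e = c • e := fun _ _ => rfl
  have hH := 𝔄.isResidueHull E hE ι hι hess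
  obtain ⟨H⟩ := hH.nonempty_hullCoordinates h𝔄 p h hs
  have hmem : ∀ b ∈ 𝔅, Ideal.Quotient.mk 𝔄 b ∈ 𝔟 := fun b hb =>
    h2 ▸ Ideal.mem_map_of_mem _ hb
  have hlift : ∀ r ∈ 𝔟, ∃ b ∈ 𝔅, Ideal.Quotient.mk 𝔄 b = r := fun r hr => by
    rwa [← h2, Ideal.mem_map_iff_of_surjective _ Ideal.Quotient.mk_surjective] at hr
  constructor
  · intro hspecial n hn u hu
    have hq : 1 ≤ p ^ n := Nat.one_le_pow _ _ (Fact.out : p.Prime).pos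
    have hu' : ∀ a ∈ 𝔄, u * a ∈ 𝔄.bracketPow (p ^ n) := fun a ha => Submodule.mem_colon.mp hu a ha
    obtain ⟨ψ, hψ, hψθ⟩ := H.exists_semilinear p n h hs hH hu'
    refine Submodule.mem_colon.mpr fun b hb => Ideal.mem_of_forall_mem_sup_pow _ fun t => ?_
    cases t with
    | zero => simp
    | succ t =>
      have ht : 1 ≤ (t + 1) * p ^ n := Nat.mul_pos t.succ_pos hq
      have hsup : b * u ∈ 𝔅.bracketPow (p ^ n) ⊔ Ideal.constPowSpan s ((t + 1) * p ^ n) := by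
        refine h.mem_bracketPow_sup p n hs _ _ fun w hw => ?_
        have hw' : ∀ a ∈ 𝔄, a * w ∈ Ideal.constPowSpan s (t + 1) := fun a ha => hw a (h1 ha)
        have hkill : ∀ r ∈ 𝔟, r • H.θ (t + 1) w = 0 := fun r hr => by
          obtain ⟨c, hc, rfl⟩ := hlift r hr
          rw [hmk, H.smul_eq_zero_iff t.succ_pos hw']
          exact hw c hc
        have h3 := FrobBC.smul_apply_eq_zero ψ (fun r e => by
          obtain ⟨c, rfl⟩ := Ideal.Quotient.mk_surjective r
          rw [← map_pow, hmk, hmk, hψ]) (hspecial n hn _ (hmem b hb) _ hkill)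
        rw [hmk, hψθ _ _ t.succ_pos hw', H.smul_eq_zero_iff ht] at h3
        · rwa [mul_assoc]
        · intro a ha
          rw [← mul_assoc, mul_comm a u]
          exact HullCoordinates.mul_pow_mem_of_mem_bracketPow p n hw' (hu' a ha)
      have hle : Ideal.constPowSpan s ((t + 1) * p ^ n) ≤ maximalIdeal S ^ (t + 1) :=
        hs ▸ (Ideal.constPowSpan_le_pow _).trans
          (Ideal.pow_le_pow_right (Nat.le_mul_of_pos_right _ hq))
      rw [smul_eq_mul, mul_comm]
      exact SetLike.le_def.mp (sup_le_sup_left hle _) hsup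
  · intro hcolon n hn r hr e he
    have hq : 1 ≤ p ^ n := Nat.one_le_pow _ _ (Fact.out : p.Prime).pos
    by_contra hne
    obtain ⟨ψ, hψ, hψr⟩ := FrobBC.exists_smul_apply_ne_zero hE ι hι hne
    have hψ' : ∀ (c : S) e, ψ (c • e) = c ^ p ^ n • ψ e := fun c e => by
      rw [← hmk, hψ, ← map_pow, hmk]
    obtain ⟨b, hb, rfl⟩ := hlift r hr
    obtain ⟨t, w, ht, hw, rfl⟩ := H.exists_rep hs hH e
    have hw𝔅 : ∀ c ∈ 𝔅, c * w ∈ Ideal.constPowSpan s t := fun c hc =>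
      (H.smul_eq_zero_iff ht hw c).mp (he _ (hmem c hc))
    obtain ⟨N, hN⟩ := Ideal.exists_pow_le_constPowSpan (s := s) (t * p ^ n)
    obtain ⟨T, hT⟩ :=
      Ideal.exists_sub_mem_pow_of_mul_mem_sup (Ideal.span (s : Set S)) 𝔄 (𝔄.bracketPow (p ^ n)) N
    have htT : 1 ≤ t + T := ht.trans (Nat.le_add_right _ _)
    obtain ⟨u, hu⟩ := H.exists_multiplier p n h hs ψ hψ' htT
    obtain ⟨u', hu', huu'⟩ := hT ((t + T) * p ^ n)
      ((Nat.le_add_left _ _).trans (Nat.le_mul_of_pos_right _ hq)) u fun a ha => by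
        rw [mul_comm u a]
        refine SetLike.le_def.mp (sup_le_sup_left (Ideal.constPowSpan_le_pow _) _)
          (h.mem_bracketPow_sup p n hs _ _ fun v hv => ?_)
        rw [mul_assoc]
        exact (hu v hv).1 a ha
    have hu'b : u' * b ∈ 𝔅.bracketPow (p ^ n) :=
      Submodule.mem_colon.mp (hcolon n hn (Submodule.mem_colon.mpr hu')) b hb
    obtain ⟨hcol, hval⟩ := hu _ (HullCoordinates.mul_mem_prod_pow h T hw)
    apply hψr
    rw [hmk, ← H.prod_pow_mul T ht hw, hval, H.smul_eq_zero_iff (Nat.mul_pos htT hq) hcol]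
    have h3 : b * (u * ((∏ x ∈ s, x) ^ T * w) ^ p ^ n) =
        (∏ x ∈ s, x) ^ (T * p ^ n) * (u' * b * w ^ p ^ n + b * w ^ p ^ n * (u - u')) := by
      ring
    rw [h3, add_mul, h.prod_pow_mul_mem_iff]
    exact Ideal.add_mem _ (HullCoordinates.mul_pow_mem_of_mem_bracketPow p n hw𝔅 hu'b)
      (Ideal.mul_mem_left _ _ (hN huu'))
end

section
/- Let S be a regular local ring of characteristic p, let n ≥ 1 and q = p^n. Then: (i) for ideals 𝔅₁, …, 𝔅_t of S, (𝔅₁ ∩ ⋯ ∩ 𝔅_t)^{[q]} = 𝔅₁^{[q]} ∩ ⋯ ∩ 𝔅_t^{[q]}; (ii) if 𝔔 is a 𝔓-primary ideal of S, then 𝔔^{[q]} is also 𝔓-primary; (iii) if 𝔄 is an ideal of S with 0 ≠ 𝔄 ≠ S and 𝔄 = 𝔔₁ ∩ ⋯ ∩ 𝔔_t is a minimal primary decomposition of 𝔄, then 𝔄^{[q]} = 𝔔₁^{[q]} ∩ ⋯ ∩ 𝔔_t^{[q]} is a minimal primary decomposition of 𝔄^{[q]}. -/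
open TensorProduct IsLocalRing DirectSum

universe u v

section

open scoped Matrix

/-- A weak form of `IsRegularLocal` with an explicit dimension. -/
def RegularOfDim (S : Type u) [CommRing S] [IsLocalRing S] (d : ℕ) : Prop :=
  (∃ s : Finset S, s.card ≤ d ∧ Ideal.span (s : Set S) = maximalIdeal S) ∧
    (d : WithBot ℕ∞) ≤ ringKrullDim S

namespace RegularOfDim

variable {S : Type u} [CommRing S] [IsLocalRing S]

theorem quotient [IsNoetherianRing S] {d : ℕ} (h : RegularOfDim S (d + 1)) {x : S}
    (hx : x ∈ maximalIdeal S) (hx2 : x ∉ maximalIdeal S ^ 2) [IsLocalRing (S ⧸ Ideal.span {x})] :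
    RegularOfDim (S ⧸ Ideal.span {x}) d := by
  classical
  obtain ⟨⟨s, hs, hsm⟩, hd⟩ := h
  refine ⟨?_, ?_⟩
  · obtain ⟨a, -, ha⟩ := Submodule.mem_span_finset.1 (by rwa [← hsm] at hx)
    have hunit : ∃ i ∈ s, IsUnit (a i) := by
      by_contra! H
      refine hx2 (ha ▸ Ideal.sum_mem _ fun i hi ↦ ?_)
      rw [pow_two]
      exact Ideal.mul_mem_mul ((mem_maximalIdeal _).2 (H i hi))
        (hsm ▸ Ideal.subset_span hi)
    obtain ⟨i, hi, hu⟩ := hunit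
    refine ⟨(s.erase i).image (Ideal.Quotient.mk (Ideal.span {x})), ?_, ?_⟩
    · have := Finset.card_image_le (s := s.erase i) (f := Ideal.Quotient.mk (Ideal.span {x}))
      rw [Finset.card_erase_of_mem hi] at this
      omega
    · rw [← map_maximalIdeal_of_surjective _ (Ideal.Quotient.mk_surjective (I := Ideal.span {x})),
        ← hsm, Ideal.map_span, Finset.coe_image]
      refine le_antisymm (Ideal.span_mono (Set.image_mono (by simp))) (Ideal.span_le.2 ?_)
      rintro _ ⟨j, hj, rfl⟩
      by_cases hji : j = i
      · subst hji
        rw [SetLike.mem_coe, ← Ideal.unit_mul_mem_iff_mem _ (hu.map (Ideal.Quotient.mk _)),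
          ← map_mul]
        have hax : a j * j = x - ∑ k ∈ s.erase j, a k * k := by
          rw [← ha, ← Finset.add_sum_erase s _ hi]
          simp
        rw [hax, map_sub, Ideal.Quotient.eq_zero_iff_mem.2 (Ideal.mem_span_singleton_self x),
          zero_sub, neg_mem_iff, map_sum]
        refine Ideal.sum_mem _ fun k hk ↦ ?_
        rw [map_mul]
        exact Ideal.mul_mem_left _ _ (Ideal.subset_span ⟨k, hk, rfl⟩)
      · exact Ideal.subset_span ⟨j, by simpa [hji] using hj, rfl⟩
  · have h1 := ringKrullDim_le_ringKrullDim_quotient_add_card {x} (by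
      simpa [IsLocalRing.ringJacobson_eq_maximalIdeal] using hx)
    have h2 : ((d : WithBot ℕ∞) + 1) ≤ ringKrullDim (S ⧸ Ideal.span {x}) + 1 := by
      rw [Finset.coe_singleton, Finset.card_singleton] at h1
      exact_mod_cast hd.trans h1
    exact ENat.WithBot.add_le_add_one_right_iff.1 h2

theorem exists_mem [IsNoetherianRing S] {d : ℕ} (h : RegularOfDim S (d + 1)) :
    ∃ x ∈ maximalIdeal S, x ∉ maximalIdeal S ^ 2 ∧ ∀ P ∈ minimalPrimes S, x ∉ P := by
  classical
  have hfin := minimalPrimes.finite_of_isNoetherianRing S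
  have hht : ∀ P ∈ minimalPrimes S, ¬ maximalIdeal S ≤ P := fun P hP hle ↦ by
    have := hP.1.1
    have hPm : maximalIdeal S = P := hle.antisymm (le_maximalIdeal this.ne_top)
    have h0 : (maximalIdeal S).height = 0 := by
      rw [hPm]
      exact nonpos_iff_eq_zero.1 (Ideal.height_le_iff.2 fun Q hQ hlt ↦
        absurd (hP.2 ⟨hQ, bot_le⟩ hlt.le) hlt.not_ge)
    have := h.2
    rw [← maximalIdeal_height_eq_ringKrullDim, h0] at this
    norm_cast at this
  have key := (Ideal.subset_union_prime (s := insert (maximalIdeal S ^ 2) hfin.toFinset)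
    (f := id) (maximalIdeal S ^ 2) (maximalIdeal S ^ 2) (I := maximalIdeal S) (by
      intro i hi h1 _
      simp only [Finset.mem_insert, h1, false_or, Set.Finite.mem_toFinset] at hi
      exact hi.1.1)).not.2 (by
      rintro ⟨i, hi, hle⟩
      rw [Finset.mem_insert, Set.Finite.mem_toFinset] at hi
      obtain rfl | hi := hi
      · have hbot : maximalIdeal S = ⊥ :=
          Submodule.eq_bot_of_le_smul_of_le_jacobson_bot (maximalIdeal S) _
            (IsNoetherian.noetherian _) (by simpa [pow_two] using hle) (maximalIdeal_le_jacobson _)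
        obtain ⟨P, hP⟩ := Ideal.nonempty_minimalPrimes (I := (⊥ : Ideal S)) bot_ne_top
        exact hht P hP (hbot ▸ bot_le)
      · exact hht i hi hle)
  obtain ⟨x, hx, hx'⟩ := Set.not_subset.1 key
  simp only [Set.mem_iUnion, not_exists] at hx'
  exact ⟨x, hx, hx' _ (by simp), fun P hP ↦ hx' P (by simp [hP])⟩

theorem maximalIdeal_eq_bot (h : RegularOfDim S 0) : maximalIdeal S = ⊥ := by
  obtain ⟨⟨s, hs, hsm⟩, -⟩ := h
  rw [← hsm, Finset.card_eq_zero.1 (Nat.le_zero.1 hs)]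
  simp

theorem isDomain {d : ℕ} : ∀ {S : Type u} [CommRing S] [IsLocalRing S] [IsNoetherianRing S],
    RegularOfDim S d → IsDomain S := by
  induction d with
  | zero => exact fun h ↦ (isField_iff_maximalIdeal_eq.2 h.maximalIdeal_eq_bot).isDomain
  | succ d ih =>
    intro S _ _ _ h
    obtain ⟨x, hx, hx2, hmin⟩ := h.exists_mem
    have hnt : Nontrivial (S ⧸ Ideal.span {x}) := Ideal.Quotient.nontrivial_iff.2
      (Ideal.span_singleton_ne_top ((mem_maximalIdeal _).1 hx))
    have : IsLocalRing (S ⧸ Ideal.span {x}) :=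
      .of_surjective' _ Ideal.Quotient.mk_surjective
    have := ih (h.quotient hx hx2)
    have hprime := (Ideal.Quotient.isDomain_iff_prime _).1 this
    obtain ⟨P, hP, hPx⟩ := Ideal.exists_minimalPrimes_le (I := ⊥) (J := Ideal.span {x}) bot_le
    have hPp := hP.1.1
    have hPbot : P = ⊥ := by
      refine Submodule.eq_bot_of_le_smul_of_le_jacobson_bot (maximalIdeal S) _
        (IsNoetherian.noetherian _) (fun y hy ↦ ?_) (maximalIdeal_le_jacobson _)
      obtain ⟨a, rfl⟩ := Ideal.mem_span_singleton.1 (hPx hy)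
      exact Ideal.mul_mem_mul hx ((hPp.mem_or_mem hy).resolve_left (hmin P hP))
    exact IsDomain.of_bot_isPrime S (hbp := hPbot ▸ hPp)

end RegularOfDim

/-- The span of the entrywise `q`-th powers of the vectors `u` with `u ⬝ᵥ s ∈ K`. -/
def frobSyz {R : Type u} [CommRing R] {ι : Type} [Fintype ι] (q : ℕ) (s : ι → R) (K : Ideal R) :
    Submodule R (ι → R) :=
  Submodule.span R ((fun u ↦ u ^ q) '' {u | u ⬝ᵥ s ∈ K})

/-- Every linear relation on `q`-th powers is a combination of `q`-th powers of relations; this is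
the equational form of flatness of the `q`-th power map. -/
def FrobeniusFlat (R : Type u) [CommRing R] (q : ℕ) : Prop :=
  ∀ (ι : Type) [Fintype ι] (s t : ι → R), t ⬝ᵥ s ^ q = 0 → t ∈ frobSyz q s ⊥

section FrobSyz

variable {R : Type u} [CommRing R] {p n : ℕ} [Fact p.Prime] [CharP R p]
variable {ι κ : Type} [Fintype ι] [Fintype κ]

theorem pow_mem_frobSyz {q : ℕ} {s u : ι → R} {K : Ideal R} (h : u ⬝ᵥ s ∈ K) :
    u ^ q ∈ frobSyz q s K :=
  Submodule.subset_span ⟨u, h, rfl⟩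

theorem dotProduct_pow_char_pow (u s : ι → R) :
    (u ⬝ᵥ s) ^ p ^ n = u ^ p ^ n ⬝ᵥ s ^ p ^ n := by
  simp [dotProduct, sum_pow_char_pow, mul_pow]

theorem dotProduct_pow_mem_of_mem_frobSyz {s t : ι → R} {K : Ideal R}
    (h : t ∈ frobSyz (p ^ n) s K) : t ⬝ᵥ s ^ p ^ n ∈ K.bracketPow (p ^ n) := by
  refine Submodule.span_induction ?_ (by simp) (fun x y _ _ hx hy ↦ ?_) (fun a x _ hx ↦ ?_) h
  · rintro _ ⟨u, hu, rfl⟩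
    rw [← dotProduct_pow_char_pow]
    exact Ideal.subset_span ⟨_, hu, rfl⟩
  · rw [add_dotProduct]
    exact add_mem hx hy
  · rw [smul_dotProduct, smul_eq_mul]
    exact Ideal.mul_mem_left _ _ hx

theorem dotProduct_pow_eq_zero_of_mem_frobSyz {s t : ι → R} (h : t ∈ frobSyz (p ^ n) s ⊥) :
    t ⬝ᵥ s ^ p ^ n = 0 := by
  have h0 : (⊥ : Ideal R).bracketPow (p ^ n) = ⊥ := by
    simp [Ideal.bracketPow, (Fact.out : p.Prime).ne_zero]
  simpa [h0] using dotProduct_pow_mem_of_mem_frobSyz h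

theorem linearCombination_pow_mem_frobSyz {s : ι → R} {V c : κ → R} {U : κ → ι → R}
    {K L : Ideal R} (hU : ∀ z, z ⬝ᵥ V ∈ L → Fintype.linearCombination R U z ⬝ᵥ s ∈ K)
    (hc : c ∈ frobSyz (p ^ n) V L) :
    Fintype.linearCombination R (fun k ↦ U k ^ p ^ n) c ∈ frobSyz (p ^ n) s K := by
  suffices h : frobSyz (p ^ n) V L ≤
      (frobSyz (p ^ n) s K).comap (Fintype.linearCombination R fun k ↦ U k ^ p ^ n) from h hc
  refine Submodule.span_le.2 ?_
  rintro _ ⟨z, hz, rfl⟩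
  have : Fintype.linearCombination R (fun k ↦ U k ^ p ^ n) (z ^ p ^ n) =
      Fintype.linearCombination R U z ^ p ^ n := by
    ext i
    simp [Fintype.linearCombination_apply, sum_pow_char_pow, mul_pow]
  rw [SetLike.mem_coe, Submodule.mem_comap, this]
  exact pow_mem_frobSyz (hU z hz)

theorem smul_sub_smul_mem_frobSyz {s a : ι → R} {x : R} (hx : a ⬝ᵥ s = x) (t : ι → R) :
    x ^ p ^ n • t - (t ⬝ᵥ s ^ p ^ n) • a ^ p ^ n ∈ frobSyz (p ^ n) s ⊥ := by
  classical
  have key : x ^ p ^ n • t - (t ⬝ᵥ s ^ p ^ n) • a ^ p ^ n =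
      ∑ j, t j • (x • Pi.single j 1 - s j • a) ^ p ^ n := by
    ext i
    simp only [Pi.sub_apply, Pi.smul_apply, Pi.pow_apply, smul_eq_mul, Finset.sum_apply,
      sub_pow_char_pow, mul_pow, mul_sub, Finset.sum_sub_distrib, dotProduct, Finset.sum_mul]
    congr 1
    · rw [Finset.sum_eq_single i]
      · simp [mul_comm]
      · intro b _ hb
        simp [hb.symm, (Fact.out : p.Prime).ne_zero]
      · simp
    · simp [mul_assoc]
  rw [key]
  refine sum_mem fun j _ ↦ Submodule.smul_mem _ _ (pow_mem_frobSyz ?_)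
  simp [sub_dotProduct, hx, mul_comm]

theorem exists_lift_frobSyz {q : ℕ} {x : R} {s : ι → R} {t : ι → R ⧸ Ideal.span {x}}
    (h : t ∈ frobSyz q (Ideal.Quotient.mk (Ideal.span {x}) ∘ s) ⊥) :
    ∃ r ∈ frobSyz q s (Ideal.span {x}), Ideal.Quotient.mk (Ideal.span {x}) ∘ r = t := by
  refine Submodule.span_induction ?_ ⟨0, zero_mem _, by ext; simp⟩ ?_ ?_ h
  · rintro _ ⟨u, hu, rfl⟩
    choose v hv using fun i ↦ Ideal.Quotient.mk_surjective (I := Ideal.span {x}) (u i)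
    refine ⟨v ^ q, pow_mem_frobSyz (Ideal.Quotient.eq_zero_iff_mem.1 ?_), by ext; simp [hv]⟩
    simpa [dotProduct, hv] using hu
  · rintro _ _ _ _ ⟨r, hr, rfl⟩ ⟨r', hr', rfl⟩
    exact ⟨r + r', add_mem hr hr', by ext; simp⟩
  · rintro a _ _ ⟨r, hr, rfl⟩
    obtain ⟨b, rfl⟩ := Ideal.Quotient.mk_surjective a
    exact ⟨b • r, Submodule.smul_mem _ _ hr, by ext; simp⟩

theorem exists_eq_add_smul_of_quotient [IsDomain R] {x : R} (hx : x ≠ 0)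
    (hflat : FrobeniusFlat (R ⧸ Ideal.span {x}) (p ^ n)) {s t : ι → R}
    (h : t ⬝ᵥ s ^ p ^ n = 0) :
    ∃ r ∈ frobSyz (p ^ n) s (Ideal.span {x}), ∃ t', t = r + x ^ p ^ n • t' := by
  suffices H : ∀ j ≤ p ^ n, ∃ r ∈ frobSyz (p ^ n) s (Ideal.span {x}), ∃ t', t = r + x ^ j • t' from
    H _ le_rfl
  intro j hj
  induction j with
  | zero => exact ⟨0, zero_mem _, t, by simp⟩
  | succ j ih =>
    obtain ⟨r, hr, t', rfl⟩ := ih (by omega)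
    have hdvd : x ^ (j + 1) ∣ x ^ j * (t' ⬝ᵥ s ^ p ^ n) := by
      have hr' := dotProduct_pow_mem_of_mem_frobSyz hr
      have hle : (Ideal.span {x}).bracketPow (p ^ n) ≤ Ideal.span {x ^ (j + 1)} := by
        refine Ideal.span_le.2 ?_
        rintro _ ⟨y, hy, rfl⟩
        exact Ideal.mem_span_singleton.2
          ((pow_dvd_pow x hj).trans (pow_dvd_pow_of_dvd (Ideal.mem_span_singleton.1 hy) _))
      rw [add_dotProduct, smul_dotProduct, smul_eq_mul, add_comm] at h
      rw [eq_neg_of_add_eq_zero_left h, dvd_neg]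
      exact Ideal.mem_span_singleton.1 (hle hr')
    rw [pow_succ, mul_dvd_mul_iff_left (pow_ne_zero _ hx)] at hdvd
    obtain ⟨r', hr', hrt⟩ := exists_lift_frobSyz (s := s) (hflat ι
      (Ideal.Quotient.mk (Ideal.span {x}) ∘ s) (Ideal.Quotient.mk (Ideal.span {x}) ∘ t') (by
        have := Ideal.Quotient.eq_zero_iff_mem.2 (Ideal.mem_span_singleton.2 hdvd)
        simpa [dotProduct] using this))
    have hex : ∀ i, ∃ c, t' i - r' i = x * c := fun i ↦ Ideal.mem_span_singleton.1
      (Ideal.Quotient.eq.1 (congrFun hrt i).symm)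
    choose c hc using hex
    refine ⟨r + x ^ j • r', add_mem hr (Submodule.smul_mem _ _ hr'), c, ?_⟩
    ext i
    simp only [Pi.add_apply, Pi.smul_apply, smul_eq_mul]
    linear_combination x ^ j * hc i

end FrobSyz

section Induction

variable {R : Type u} [CommRing R] {p n : ℕ} [Fact p.Prime] [CharP R p]
variable {ι : Type} [Fintype ι]

theorem mem_frobSyz_of_mem_span [IsDomain R] {x : R} (hx : x ≠ 0)
    (hflat : FrobeniusFlat (R ⧸ Ideal.span {x}) (p ^ n)) {s t : ι → R}
    (hxs : x ∈ Ideal.span (Set.range s)) (h : t ⬝ᵥ s ^ p ^ n = 0) :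
    t ∈ frobSyz (p ^ n) s ⊥ := by
  obtain ⟨a, ha⟩ := Ideal.mem_span_range_iff_exists_fun.1 hxs
  change a ⬝ᵥ s = x at ha
  have hle : frobSyz (p ^ n) s (Ideal.span {x}) ≤
      frobSyz (p ^ n) s ⊥ ⊔ Submodule.span R {a ^ p ^ n} := by
    refine Submodule.span_le.2 ?_
    rintro _ ⟨u, hu, rfl⟩
    obtain ⟨w, hw⟩ := Ideal.mem_span_singleton.1 hu
    have hmem : u - w • a ∈ {v : ι → R | v ⬝ᵥ s ∈ (⊥ : Ideal R)} := by
      simp [sub_dotProduct, hw, ha, mul_comm]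
    refine Submodule.mem_sup.2 ⟨_, pow_mem_frobSyz hmem, w ^ p ^ n • a ^ p ^ n,
      Submodule.smul_mem _ _ (Submodule.mem_span_singleton_self _), ?_⟩
    ext i
    simp [sub_pow_char_pow, mul_pow]
  obtain ⟨r, hr, t', rfl⟩ := exists_eq_add_smul_of_quotient hx hflat h
  obtain ⟨r', hr', z, hz, rfl⟩ := Submodule.mem_sup.1 (hle hr)
  obtain ⟨c, rfl⟩ := Submodule.mem_span_singleton.1 hz
  have hc : c = -(t' ⬝ᵥ s ^ p ^ n) := by
    rw [add_dotProduct, add_dotProduct, dotProduct_pow_eq_zero_of_mem_frobSyz hr', smul_dotProduct,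
      smul_dotProduct, ← dotProduct_pow_char_pow, ha, smul_eq_mul, smul_eq_mul] at h
    refine mul_left_cancel₀ (pow_ne_zero (p ^ n) hx) ?_
    linear_combination h
  have := add_mem hr' (smul_sub_smul_mem_frobSyz (p := p) (n := n) ha t')
  convert this using 1
  rw [hc, neg_smul]
  abel

theorem mem_frobSyz_of_colon_le [IsDomain R] [IsNoetherianRing R] [IsLocalRing R] {x : R}
    (hx : x ≠ 0) (hxm : x ∈ maximalIdeal R)
    (hflat : FrobeniusFlat (R ⧸ Ideal.span {x}) (p ^ n)) {s t : ι → R}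
    (hcolon : ∀ w, x * w ∈ Ideal.span (Set.range s) → w ∈ Ideal.span (Set.range s))
    (h : t ⬝ᵥ s ^ p ^ n = 0) : t ∈ frobSyz (p ^ n) s ⊥ := by
  let N := LinearMap.ker (Fintype.linearCombination R (s ^ p ^ n))
  have hN {v : ι → R} : v ∈ N ↔ v ⬝ᵥ s ^ p ^ n = 0 := Iff.rfl
  have hle : frobSyz (p ^ n) s (Ideal.span {x}) ≤
      frobSyz (p ^ n) s ⊥ ⊔ LinearMap.range (LinearMap.lsmul R (ι → R) (x ^ p ^ n)) := by
    refine Submodule.span_le.2 ?_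
    rintro _ ⟨u, hu, rfl⟩
    obtain ⟨w, hw⟩ := Ideal.mem_span_singleton.1 hu
    have hws := hcolon w (hw ▸ Ideal.mem_span_range_iff_exists_fun.2 ⟨u, rfl⟩)
    obtain ⟨v, hv⟩ := Ideal.mem_span_range_iff_exists_fun.1 hws
    change v ⬝ᵥ s = w at hv
    have hmem : (u - x • v) ⬝ᵥ s ∈ (⊥ : Ideal R) := by simp [sub_dotProduct, hw, hv]
    refine Submodule.mem_sup.2 ⟨_, pow_mem_frobSyz hmem, _, ⟨v ^ p ^ n, rfl⟩, ?_⟩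
    ext i
    simp [sub_pow_char_pow, mul_pow]
  suffices hNle : N ≤ frobSyz (p ^ n) s ⊥ from hNle (hN.2 h)
  refine Submodule.le_of_le_smul_of_le_jacobson_bot (IsNoetherian.noetherian _)
    (maximalIdeal_le_jacobson _) fun t ht ↦ ?_
  obtain ⟨r, hr, t₁, rfl⟩ := exists_eq_add_smul_of_quotient hx hflat (hN.1 ht)
  obtain ⟨r', hr', _, ⟨t₂, rfl⟩, rfl⟩ := Submodule.mem_sup.1 (hle hr)
  rw [LinearMap.lsmul_apply, add_assoc, ← smul_add] at ht ⊢
  refine Submodule.mem_sup.2 ⟨r', hr', _, Submodule.smul_mem_smul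
    (Ideal.pow_mem_of_mem _ hxm _ (pow_pos (Fact.out : p.Prime).pos n)) ?_, rfl⟩
  rw [hN, add_dotProduct, dotProduct_pow_eq_zero_of_mem_frobSyz hr', zero_add, smul_dotProduct,
    smul_eq_mul] at ht
  exact hN.2 ((mul_eq_zero.1 ht).resolve_left (pow_ne_zero _ hx))

theorem mem_frobSyz_of_extension [IsNoetherianRing R] {x : R} {s t : ι → R}
    (hsup : ∀ t' : ι ⊕ Unit → R, t' ⬝ᵥ (Sum.elim s fun _ ↦ x) ^ p ^ n = 0 →
      t' ∈ frobSyz (p ^ n) (Sum.elim s fun _ ↦ x) ⊥)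
    (hcolon : ∀ (κ : Type) [Fintype κ] (V c : κ → R),
      (∀ w, w ∈ Ideal.span (Set.range V) ↔ x * w ∈ Ideal.span (Set.range s)) →
      c ⬝ᵥ V ^ p ^ n = 0 → c ∈ frobSyz (p ^ n) V ⊥)
    (h : t ⬝ᵥ s ^ p ^ n = 0) : t ∈ frobSyz (p ^ n) s ⊥ := by
  have hpow {α β : Type} (f : α → R) (g : β → R) :
      Sum.elim f g ^ p ^ n = Sum.elim (f ^ p ^ n) (g ^ p ^ n) := by
    ext (i | i) <;> rfl
  have ht := hsup (Sum.elim t 0) (by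
    rw [hpow, sumElim_dotProduct_sumElim, h, zero_dotProduct, add_zero])
  obtain ⟨k, c, g, hg⟩ := Submodule.mem_span_set'.1 ht
  choose u hu hug using fun i ↦ (g i).2
  let J : Ideal R := (Ideal.span (Set.range s)).colon {x}
  have hJ {w : R} : w ∈ J ↔ x * w ∈ Ideal.span (Set.range s) := by
    rw [Submodule.mem_colon_singleton, smul_eq_mul, mul_comm]
  obtain ⟨m, V', hV'⟩ := Submodule.fg_iff_exists_fin_generating_family.1 (IsNoetherian.noetherian J)
  have hV'J (i) : V' i ∈ J := hV' ▸ Submodule.subset_span ⟨i, rfl⟩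
  choose U' hU' using fun i ↦ Ideal.mem_span_range_iff_exists_fun.1 (neg_mem (hJ.1 (hV'J i)))
  let V : Fin k → R := fun i ↦ u i (.inr ())
  let U : Fin k → ι → R := fun i j ↦ u i (.inl j)
  have hU (i) : U i ⬝ᵥ s = -(x * V i) := by
    have : (Sum.elim (U i) fun _ ↦ V i) = u i := by ext (j | j) <;> rfl
    have := this ▸ hu i
    simp only [Set.mem_ofPred_eq, Ideal.mem_bot, sumElim_dotProduct_sumElim] at this
    rw [eq_neg_of_add_eq_zero_left this]
    simp [dotProduct, mul_comm]
  have hVJ (i) : V i ∈ J :=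
    hJ.2 (neg_mem_iff.1 (hU i ▸ Ideal.mem_span_range_iff_exists_fun.2 ⟨U i, rfl⟩))
  have hc := hcolon (Fin k ⊕ Fin m) (Sum.elim V V') (Sum.elim c 0) (fun w ↦ by
      rw [← hJ, Set.Sum.elim_range, Ideal.span_union]
      have : Ideal.span (Set.range V') = J := hV'
      rw [this, sup_eq_right.2 (Ideal.span_le.2 (by rintro _ ⟨i, rfl⟩; exact hVJ i))]) (by
      rw [hpow, sumElim_dotProduct_sumElim, zero_dotProduct, add_zero]
      have := congrFun hg (.inr ())
      simp only [Finset.sum_apply, Pi.smul_apply, smul_eq_mul, ← hug, Sum.elim_inr] at this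
      exact this)
  have := linearCombination_pow_mem_frobSyz (s := s) (K := ⊥) (U := Sum.elim U U') (fun z hz ↦ ?_) hc
  · convert this
    ext j
    have := congrFun hg (.inl j)
    simp only [Finset.sum_apply, Pi.smul_apply, smul_eq_mul, ← hug, Sum.elim_inl] at this
    rw [← this]
    simp [Fintype.linearCombination_apply, U]
  · have hUV (i) : Sum.elim U U' i ⬝ᵥ s = -(x * Sum.elim V V' i) := by
      obtain i | i := i
      · exact hU i
      · exact hU' i
    rw [Ideal.mem_bot] at hz ⊢
    simp only [Fintype.linearCombination_apply, sum_dotProduct, smul_dotProduct, hUV, smul_eq_mul,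
      mul_neg, Finset.sum_neg_distrib, mul_left_comm _ x, ← Finset.mul_sum]
    change -(x * (z ⬝ᵥ _)) = 0
    simp [hz]

theorem FrobeniusFlat.of_quotient [IsDomain R] [IsNoetherianRing R] [IsLocalRing R] {x : R}
    (hx : x ≠ 0) (hxm : x ∈ maximalIdeal R)
    (hflat : FrobeniusFlat (R ⧸ Ideal.span {x}) (p ^ n)) : FrobeniusFlat R (p ^ n) := by
  suffices H : ∀ (I : Ideal R) (ι : Type) [Fintype ι] (s t : ι → R), Ideal.span (Set.range s) = I →
      t ⬝ᵥ s ^ p ^ n = 0 → t ∈ frobSyz (p ^ n) s ⊥ from fun ι _ s t ↦ H _ ι s t rfl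
  intro I
  induction I using WellFoundedGT.induction with | _ I ih
  intro ι _ s t hs h
  by_cases hxI : x ∈ I
  · exact mem_frobSyz_of_mem_span hx hflat (hs ▸ hxI) h
  by_cases hcolon : ∀ w, x * w ∈ I → w ∈ I
  · exact mem_frobSyz_of_colon_le hx hxm hflat (hs ▸ hcolon) h
  push Not at hcolon
  obtain ⟨y, hxy, hy⟩ := hcolon
  refine mem_frobSyz_of_extension (x := x) (fun t' ht' ↦ ?_) (fun κ _ V c hV hc ↦ ?_) h
  · refine ih _ (lt_of_le_of_ne ?_ ?_) _ _ t' rfl ht'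
    · rw [← hs, Set.Sum.elim_range]
      exact Ideal.span_mono Set.subset_union_left
    · rintro rfl
      exact hxI (Ideal.subset_span ⟨.inr (), rfl⟩)
  · refine ih _ (lt_of_le_of_ne (fun w hw ↦ ?_) ?_) _ V c rfl hc
    · rw [hV, hs]
      exact I.mul_mem_left x hw
    · rintro rfl
      exact hy ((hV y).2 (hs ▸ hxy))

end Induction

theorem FrobeniusFlat.of_isField {R : Type u} [CommRing R] (hR : IsField R) {p n : ℕ}
    [Fact p.Prime] [CharP R p] : FrobeniusFlat R (p ^ n) := by
  classical
  intro ι _ s t h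
  by_cases hs : s = 0
  · have ht : t = ∑ j, t j • (Pi.single j 1 : ι → R) ^ p ^ n := by
      ext i
      rw [Finset.sum_apply, Finset.sum_eq_single i] <;>
        simp +contextual [(Fact.out : p.Prime).ne_zero, eq_comm]
    rw [ht]
    exact sum_mem fun j _ ↦ Submodule.smul_mem _ _ (pow_mem_frobSyz (by simp [hs]))
  · obtain ⟨j, hj⟩ := Function.ne_iff.1 hs
    obtain ⟨b, hb⟩ := hR.mul_inv_cancel hj
    have := smul_sub_smul_mem_frobSyz (p := p) (n := n) (s := s) (a := Pi.single j b) (x := 1)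
      (by simpa [mul_comm] using hb) t
    simpa [h] using this

theorem RegularOfDim.frobeniusFlat {d : ℕ} {p n : ℕ} [Fact p.Prime] :
    ∀ {R : Type u} [CommRing R] [IsLocalRing R] [IsNoetherianRing R] [CharP R p],
      RegularOfDim R d → FrobeniusFlat R (p ^ n) := by
  induction d with
  | zero => exact fun h ↦ .of_isField (isField_iff_maximalIdeal_eq.2 h.maximalIdeal_eq_bot)
  | succ d ih =>
    intro R _ _ _ _ h
    have := h.isDomain
    obtain ⟨x, hx, hx2, hmin⟩ := h.exists_mem
    have hnt : Nontrivial (R ⧸ Ideal.span {x}) := Ideal.Quotient.nontrivial_iff.2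
      (Ideal.span_singleton_ne_top ((mem_maximalIdeal _).1 hx))
    have : IsLocalRing (R ⧸ Ideal.span {x}) := .of_surjective' _ Ideal.Quotient.mk_surjective
    have : CharP (R ⧸ Ideal.span {x}) p := ringChar.of_eq
      (CharP.ringChar_of_prime_eq_zero Fact.out (by
        rw [← map_natCast (Ideal.Quotient.mk (Ideal.span {x})), CharP.cast_eq_zero, map_zero]))
    obtain ⟨P, hP⟩ := Ideal.nonempty_minimalPrimes (I := (⊥ : Ideal R)) bot_ne_top
    refine .of_quotient (fun h0 ↦ hmin P hP (by simp [h0])) hx (ih (h.quotient hx hx2))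

namespace Ideal

variable {R : Type u} [CommRing R] {I J : Ideal R} {q : ℕ}

theorem pow_mem_bracketPow {x : R} (hx : x ∈ I) : x ^ q ∈ I.bracketPow q :=
  subset_span ⟨x, hx, rfl⟩

theorem bracketPow_mono (h : I ≤ J) : I.bracketPow q ≤ J.bracketPow q :=
  span_mono (Set.image_mono h)

theorem bracketPow_le_self (hq : q ≠ 0) : I.bracketPow q ≤ I := by
  refine span_le.2 ?_
  rintro _ ⟨x, hx, rfl⟩
  exact pow_mem_of_mem _ hx _ (Nat.pos_of_ne_zero hq)

theorem bracketPow_top : (⊤ : Ideal R).bracketPow q = ⊤ :=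
  (eq_top_iff_one _).2 (by simpa using pow_mem_bracketPow (q := q) (Submodule.mem_top (x := (1 : R))))

theorem radical_bracketPow (hq : q ≠ 0) : (I.bracketPow q).radical = I.radical := by
  refine le_antisymm (radical_mono (bracketPow_le_self hq)) (radical_le_radical_iff.2 ?_)
  exact fun x hx ↦ ⟨q, pow_mem_bracketPow hx⟩

variable {p n : ℕ} [Fact p.Prime] [CharP R p]

theorem bracketPow_span_range {ι : Type} [Fintype ι] (f : ι → R) :
    (span (Set.range f)).bracketPow (p ^ n) = span (Set.range (f ^ p ^ n)) := by
  refine le_antisymm (span_le.2 ?_) (span_le.2 ?_)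
  · rintro _ ⟨x, hx, rfl⟩
    obtain ⟨a, rfl⟩ := mem_span_range_iff_exists_fun.1 hx
    exact mem_span_range_iff_exists_fun.2 ⟨a ^ p ^ n, (dotProduct_pow_char_pow a f).symm⟩
  · rintro _ ⟨i, rfl⟩
    exact pow_mem_bracketPow (subset_span ⟨i, rfl⟩)

theorem exists_span_range_eq [IsNoetherianRing R] (I : Ideal R) :
    ∃ (m : ℕ) (f : Fin m → R), span (Set.range f) = I :=
  Submodule.fg_iff_exists_fin_generating_family.1 (IsNoetherian.noetherian I)

end Ideal

namespace FrobeniusFlat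

variable {R : Type u} [CommRing R]

/-- If `(a, -b)` is a relation on `(f ^ q, g ^ q)`, then `a` is a combination of `q`-th powers of
vectors `u` with `u ⬝ᵥ f` in the ideal generated by the entries of `g`. -/
theorem exists_sum_eq {q : ℕ} (hflat : FrobeniusFlat R q) {ι κ : Type} [Fintype ι] [Fintype κ]
    {f a : ι → R} {g b : κ → R} (h : a ⬝ᵥ f ^ q = b ⬝ᵥ g ^ q) :
    ∃ (m : ℕ) (c : Fin m → R) (u : Fin m → ι → R),
      (∀ k, u k ⬝ᵥ f ∈ Ideal.span (Set.range g)) ∧ a = ∑ k, c k • u k ^ q := by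
  have hpow : Sum.elim f g ^ q = Sum.elim (f ^ q) (g ^ q) := by
    ext (i | i) <;> rfl
  have hab := hflat (ι ⊕ κ) (Sum.elim f g) (Sum.elim a (-b)) (by
    rw [hpow, sumElim_dotProduct_sumElim, h, neg_dotProduct, add_neg_cancel])
  obtain ⟨m, c, v, hv⟩ := Submodule.mem_span_set'.1 hab
  choose u hu huv using fun k ↦ (v k).2
  refine ⟨m, c, fun k i ↦ u k (.inl i), fun k ↦ ?_, ?_⟩
  · have hk : Sum.elim (fun i ↦ u k (.inl i)) (fun i ↦ u k (.inr i)) = u k := by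
      ext (j | j) <;> rfl
    have := hu k
    rw [Set.mem_ofPred_eq, Ideal.mem_bot, ← hk, sumElim_dotProduct_sumElim] at this
    rw [eq_neg_of_add_eq_zero_left this, neg_mem_iff]
    exact Ideal.mem_span_range_iff_exists_fun.2 ⟨_, rfl⟩
  · ext i
    have := congrFun hv (.inl i)
    simp only [Finset.sum_apply, Pi.smul_apply, ← huv] at this
    simpa using this.symm

variable {p n : ℕ} [Fact p.Prime] [CharP R p] [IsNoetherianRing R]

theorem bracketPow_inf (hflat : FrobeniusFlat R (p ^ n)) (I J : Ideal R) :
    (I ⊓ J).bracketPow (p ^ n) = I.bracketPow (p ^ n) ⊓ J.bracketPow (p ^ n) := by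
  refine le_antisymm (le_inf (Ideal.bracketPow_mono inf_le_left)
    (Ideal.bracketPow_mono inf_le_right)) fun y ⟨hyI, hyJ⟩ ↦ ?_
  obtain ⟨_, f, rfl⟩ := I.exists_span_range_eq
  obtain ⟨_, g, rfl⟩ := J.exists_span_range_eq
  rw [SetLike.mem_coe, Ideal.bracketPow_span_range] at hyI hyJ
  obtain ⟨a, rfl⟩ := Ideal.mem_span_range_iff_exists_fun.1 hyI
  obtain ⟨b, hb⟩ := Ideal.mem_span_range_iff_exists_fun.1 hyJ
  obtain ⟨m, c, u, hu, rfl⟩ := hflat.exists_sum_eq (f := f) (a := a) (g := g) (b := b) hb.symm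
  change (∑ k, c k • u k ^ p ^ n) ⬝ᵥ f ^ p ^ n ∈ _
  rw [sum_dotProduct]
  refine sum_mem fun k _ ↦ ?_
  rw [smul_dotProduct, ← dotProduct_pow_char_pow]
  exact Ideal.mul_mem_left _ _ (Ideal.pow_mem_bracketPow
    ⟨Ideal.mem_span_range_iff_exists_fun.2 ⟨u k, rfl⟩, hu k⟩)

theorem bracketPow_finset_inf (hflat : FrobeniusFlat R (p ^ n)) {α : Type*} (s : Finset α)
    (B : α → Ideal R) :
    (s.inf B).bracketPow (p ^ n) = s.inf fun i ↦ (B i).bracketPow (p ^ n) :=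
  Finset.apply_inf_eq_inf_comp (Ideal.bracketPow · (p ^ n)) hflat.bracketPow_inf
    Ideal.bracketPow_top

theorem mem_bracketPow_colon (hflat : FrobeniusFlat R (p ^ n)) {I : Ideal R} {x y : R}
    (h : y * x ^ p ^ n ∈ I.bracketPow (p ^ n)) :
    y ∈ (I.colon {x}).bracketPow (p ^ n) := by
  obtain ⟨_, g, rfl⟩ := I.exists_span_range_eq
  rw [Ideal.bracketPow_span_range] at h
  obtain ⟨b, hb⟩ := Ideal.mem_span_range_iff_exists_fun.1 h
  obtain ⟨m, c, u, hu, hy⟩ := hflat.exists_sum_eq (f := fun _ : Unit ↦ x) (a := fun _ ↦ y)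
    (g := g) (b := b) (by simpa [dotProduct] using hb.symm)
  have hy' := congrFun hy ()
  simp only [Finset.sum_apply, Pi.smul_apply, Pi.pow_apply, smul_eq_mul] at hy'
  rw [hy']
  refine sum_mem fun k _ ↦ Ideal.mul_mem_left _ _ (Ideal.pow_mem_bracketPow ?_)
  simpa [Submodule.mem_colon_singleton, dotProduct] using hu k

theorem le_of_bracketPow_le (hflat : FrobeniusFlat R (p ^ n)) {I J : Ideal R}
    (h : I.bracketPow (p ^ n) ≤ J.bracketPow (p ^ n)) : I ≤ J := by
  intro x hx
  have h1 := hflat.mem_bracketPow_colon (y := 1)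
    (by simpa using h (Ideal.pow_mem_bracketPow hx))
  have := Ideal.bracketPow_le_self (pow_ne_zero _ (Fact.out : p.Prime).ne_zero) h1
  simpa [Submodule.mem_colon_singleton] using this

theorem isPrimary_bracketPow (hflat : FrobeniusFlat R (p ^ n)) {Q : Ideal R} (hQ : Q.IsPrimary) :
    (Q.bracketPow (p ^ n)).IsPrimary := by
  have hq : p ^ n ≠ 0 := pow_ne_zero _ (Fact.out : p.Prime).ne_zero
  rw [Ideal.isPrimary_iff] at hQ ⊢
  refine ⟨fun h ↦ hQ.1 (top_le_iff.1 (h ▸ Ideal.bracketPow_le_self hq)), fun {a b} hab ↦ ?_⟩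
  rw [Ideal.radical_bracketPow hq]
  refine or_iff_not_imp_right.2 fun hb ↦ ?_
  refine Ideal.bracketPow_mono (fun y hy ↦ ?_) (hflat.mem_bracketPow_colon (I := Q) (x := b) (y := a) ?_)
  · rw [Submodule.mem_colon_singleton] at hy
    exact (hQ.2 hy).resolve_right hb
  · obtain ⟨m, hm⟩ := Nat.exists_eq_add_one_of_ne_zero hq
    rw [hm, pow_succ', ← mul_assoc, ← hm]
    exact Ideal.mul_mem_right _ _ hab

end FrobeniusFlat

end

theorem bracket_pow_inf_primary_and_decomposition (S : Type u) [CommRing S] [IsNoetherianRing S] [IsLocalRing S]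
    (p : ℕ) [Fact p.Prime] [CharP S p] (hreg : IsRegularLocal S)
    (n : ℕ) (hn : 1 ≤ n) :
    (∀ (t : ℕ) (B : Fin t → Ideal S),
        Ideal.bracketPow (⨅ i, B i) (p ^ n) = ⨅ i, Ideal.bracketPow (B i) (p ^ n)) ∧
    (∀ 𝔔 𝔓 : Ideal S, 𝔔.IsPrimary → 𝔔.radical = 𝔓 →
        (Ideal.bracketPow 𝔔 (p ^ n)).IsPrimary ∧
          (Ideal.bracketPow 𝔔 (p ^ n)).radical = 𝔓) ∧
    (∀ (𝔄 : Ideal S) (t : ℕ) (Q : Fin t → Ideal S), 𝔄 ≠ ⊥ → 𝔄 ≠ ⊤ →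
        IsMinimalPrimaryDecomposition 𝔄 Q →
        IsMinimalPrimaryDecomposition (Ideal.bracketPow 𝔄 (p ^ n))
          (fun i => Ideal.bracketPow (Q i) (p ^ n))) := by
  obtain ⟨s, hs, hsm⟩ := hreg
  have hflat : FrobeniusFlat S (p ^ n) :=
    RegularOfDim.frobeniusFlat (d := s.card) ⟨⟨s, le_rfl, hsm⟩, hs.le⟩
  have hq : p ^ n ≠ 0 := pow_ne_zero _ (Fact.out : p.Prime).ne_zero
  have hinf (t : ℕ) (B : Fin t → Ideal S) :
      Ideal.bracketPow (⨅ i, B i) (p ^ n) = ⨅ i, Ideal.bracketPow (B i) (p ^ n) := by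
    simpa [Finset.inf_univ_eq_iInf] using hflat.bracketPow_finset_inf Finset.univ B
  refine ⟨hinf, fun Q P hQ hP ↦ ⟨hflat.isPrimary_bracketPow hQ, ?_⟩, ?_⟩
  · rw [Ideal.radical_bracketPow hq, hP]
  · rintro A t Q - - ⟨rfl, hprim, hinj, hmin⟩
    refine ⟨hinf t Q, fun i ↦ hflat.isPrimary_bracketPow (hprim i), ?_, fun i h ↦ hmin i ?_⟩
    · simpa only [Ideal.radical_bracketPow hq] using hinj
    · have herase (B : Fin t → Ideal S) :
          (Finset.univ.erase i).inf B = ⨅ j, ⨅ (_ : j ≠ i), B j := by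
        simp [Finset.inf_eq_iInf]
      refine hflat.le_of_bracketPow_le ?_
      rwa [← herase, hflat.bracketPow_finset_inf, herase]
end
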